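/- arXiv:2406.04045 — 15 statements merged into one kernel-verified Lean document; each statement's English description precedes it below -/
import Mathlib

section
/- Let m and s be positive integers, let G be a finite abelian group, and let A be a subset of G of cardinality m that is an s-spanning set of G. Then the order of G is at most the Delannoy number a(m,s) = \sum_{i=0}^{m} \binom{m}{i}\binom{s}{i} 2^i. -/
/-- The Delannoy number `a(m,s) = ∑_{i=0}^m C(m,i) C(s,i) 2^i`. -/
def delannoy (m s : ℕ) : ℕ :=
  ∑ i ∈ Finset.range (m + 1), Nat.choose m i * Nat.choose s i * 2 ^ i

theorem sum_range_choose_left (s i : ℕ) :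
    ∑ k ∈ Finset.range s, Nat.choose k i = Nat.choose s (i + 1) := by
  induction s with
  | zero => simp
  | succ s ih => rw [Finset.sum_range_succ, ih, Nat.choose_succ_succ, add_comm]

theorem delannoy_succ_left (m s : ℕ) :
    delannoy (m + 1) s = delannoy m s + 2 * ∑ k ∈ Finset.range s, delannoy m k := by
  have h₁ : 2 * ∑ k ∈ Finset.range s, delannoy m k =
      ∑ i ∈ Finset.range (m + 1), Nat.choose m i * Nat.choose s (i + 1) * 2 ^ (i + 1) := by
    simp only [delannoy]
    rw [Finset.sum_comm, Finset.mul_sum]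
    refine Finset.sum_congr rfl fun i _ => ?_
    rw [← Finset.sum_mul, ← Finset.mul_sum, sum_range_choose_left]
    ring
  have h₂ : delannoy m s =
      ∑ i ∈ Finset.range (m + 1), Nat.choose m (i + 1) * Nat.choose s (i + 1) * 2 ^ (i + 1)
        + 1 := by
    rw [Finset.sum_range_succ, Nat.choose_succ_self, delannoy, Finset.sum_range_succ']
    simp
  rw [h₁, h₂, delannoy, Finset.sum_range_succ', add_right_comm, ← Finset.sum_add_distrib]
  simp only [Nat.choose_succ_succ, Nat.choose_zero_right, pow_zero, mul_one]
  congr 1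
  refine Finset.sum_congr rfl fun i _ => ?_
  ring

open scoped Classical in
/-- The elements of `G` that are signed sums over `A` of total weight at most `s`. -/
noncomputable def signedSums {G : Type*} [AddCommGroup G] [Fintype G] (A : Finset G) (s : ℕ) :
    Finset G :=
  {g | ∃ lam : G → ℤ, (∑ a ∈ A, |lam a|) ≤ (s : ℤ) ∧ g = ∑ a ∈ A, lam a • a}

section SignedSums

variable {G : Type*} [AddCommGroup G] [Fintype G]

theorem mem_signedSums {A : Finset G} {s : ℕ} {g : G} :
    g ∈ signedSums A s ↔
      ∃ lam : G → ℤ, (∑ a ∈ A, |lam a|) ≤ (s : ℤ) ∧ g = ∑ a ∈ A, lam a • a := by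
  simp [signedSums]

open scoped Classical in
theorem signedSums_insert_subset {A : Finset G} {a : G} (ha : a ∉ A) (s : ℕ) :
    signedSums (insert a A) s ⊆
      signedSums A s ∪
        ((Finset.range s).biUnion (fun k => (signedSums A k).image (((s : ℤ) - k) • a + ·)) ∪
          (Finset.range s).biUnion (fun k => (signedSums A k).image (((k : ℤ) - s) • a + ·))) := by
  intro g hg
  obtain ⟨lam, hlam, rfl⟩ := mem_signedSums.1 hg
  rw [Finset.sum_insert ha] at hlam
  rw [Finset.sum_insert ha]
  have hnonneg : 0 ≤ ∑ b ∈ A, |lam b| := Finset.sum_nonneg fun b _ => abs_nonneg _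
  simp only [Finset.mem_union, Finset.mem_biUnion, Finset.mem_range, Finset.mem_image]
  rcases lt_trichotomy (lam a) 0 with h | h | h
  · rw [abs_of_neg h] at hlam
    refine Or.inr (Or.inr ⟨(s + lam a).toNat, by omega, _,
      mem_signedSums.2 ⟨lam, by omega, rfl⟩, ?_⟩)
    rw [Int.toNat_of_nonneg (by omega), add_sub_cancel_left]
  · rw [h, abs_zero, zero_add] at hlam
    rw [h, zero_smul, zero_add]
    exact Or.inl (mem_signedSums.2 ⟨lam, hlam, rfl⟩)
  · rw [abs_of_pos h] at hlam
    refine Or.inr (Or.inl ⟨(s - lam a).toNat, by omega, _,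
      mem_signedSums.2 ⟨lam, by omega, rfl⟩, ?_⟩)
    rw [Int.toNat_of_nonneg (by omega), sub_sub_cancel]

theorem card_signedSums_le (A : Finset G) (s : ℕ) :
    (signedSums A s).card ≤ delannoy A.card s := by
  classical
  induction A using Finset.induction_on generalizing s with
  | empty =>
    simp only [delannoy, Finset.card_empty, zero_add, Finset.sum_range_one, Nat.choose_zero_right,
      pow_zero, mul_one]
    refine Finset.card_le_one.2 fun x hx y hy => ?_
    obtain ⟨_, _, rfl⟩ := mem_signedSums.1 hx
    obtain ⟨_, _, rfl⟩ := mem_signedSums.1 hy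
    simp
  | insert a A ha ih =>
    have hbound (c : ℕ → ℤ) :
        ((Finset.range s).biUnion fun k => (signedSums A k).image (c k • a + ·)).card ≤
          ∑ k ∈ Finset.range s, delannoy A.card k :=
      Finset.card_biUnion_le.trans
        (Finset.sum_le_sum fun k _ => Finset.card_image_le.trans (ih k))
    rw [Finset.card_insert_of_notMem ha, delannoy_succ_left, two_mul]
    refine (Finset.card_le_card (signedSums_insert_subset ha s)).trans ?_
    refine (Finset.card_union_le _ _).trans (add_le_add (ih s) ?_)
    exact (Finset.card_union_le _ _).trans (add_le_add (hbound _) (hbound _))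

end SignedSums


/-- **Proposition 1 (Delannoy bound).** If a finite abelian group `G` has an `m`-subset `A`
that is an `s`-spanning set (every `g ∈ G` is a signed sum `∑ a ∈ A, λ a • a` with
`∑ a ∈ A, |λ a| ≤ s`), then `|G| ≤ a(m,s) = ∑_{i=0}^m C(m,i) C(s,i) 2^i`. -/
theorem delannoy_bound_of_spanning (m s : ℕ) (hm : 0 < m) (hs : 0 < s)
    (G : Type*) [AddCommGroup G] [Fintype G] (A : Finset G) (hA : A.card = m)
    (hspan : ∀ g : G, ∃ lam : G → ℤ,
      (∑ a ∈ A, |lam a|) ≤ (s : ℤ) ∧ g = ∑ a ∈ A, lam a • a) :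
    Fintype.card G ≤ ∑ i ∈ Finset.range (m + 1),
      Nat.choose m i * Nat.choose s i * 2 ^ i := by
  rw [← Finset.card_univ, ← hA]
  exact (Finset.card_le_card fun g _ => mem_signedSums.2 (hspan g)).trans (card_signedSums_le A s)
end

section
/- Let s and n be positive integers with 2 \le n \le 2s^2 + 2s + 1. Then the two-element set {s, s+1} (where s and s+1 denote the images of the integers s and s+1 in \mathbb{Z}_n) is an s-spanning set of \mathbb{Z}_n; that is, s \ne s+1 in \mathbb{Z}_n, and every element g of \mathbb{Z}_n can be written as g = \lambda_1 \cdot s + \lambda_2 \cdot (s+1) for some integers \lambda_1, \lambda_2 with |\lambda_1| + |\lambda_2| \le s. -/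
/-- Every integer `m` with `0 ≤ m ≤ k * s + (s + k) / 2`, where `k ≤ s`, is an integral combination
of `s` and `s + 1` whose coefficients have absolute values summing to at most `s`. -/
theorem exists_combination_of_le (s k : ℕ) (hk : k ≤ s) (m : ℤ) (hm : 0 ≤ m)
    (hmk : m ≤ k * s + ((s : ℤ) + k) / 2) :
    ∃ l1 l2 : ℤ, |l1| + |l2| ≤ (s : ℤ) ∧ m = l1 * s + l2 * (s + 1) := by
  induction k with
  | zero =>
    refine ⟨-m, m, ?_, by ring⟩
    rw [abs_neg, abs_of_nonneg hm]
    simp only [Nat.cast_zero, zero_mul] at hmk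
    omega
  | succ k ih =>
    by_cases h : m ≤ k * s + ((s : ℤ) + k) / 2
    · exact ih (by omega) h
    · refine ⟨k + 1 - (m - (k + 1) * s), m - (k + 1) * s, ?_, by ring⟩
      push_cast at hmk
      rw [add_one_mul] at hmk ⊢
      generalize (k : ℤ) * s = p at *
      rcases abs_cases ((k : ℤ) + 1 - (m - (p + s))) with h1 | h1 <;>
        rcases abs_cases (m - (p + (s : ℤ))) with h2 | h2 <;> omega

/-- Every integer of absolute value at most `s ^ 2 + s` is an integral combination of `s` and
`s + 1` whose coefficients have absolute values summing to at most `s`. -/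
theorem exists_combination_of_abs_le (s : ℕ) (m : ℤ) (hm : |m| ≤ (s : ℤ) ^ 2 + s) :
    ∃ l1 l2 : ℤ, |l1| + |l2| ≤ (s : ℤ) ∧ m = l1 * s + l2 * (s + 1) := by
  obtain ⟨l1, l2, hl, h⟩ := exists_combination_of_le s s le_rfl |m| (abs_nonneg m) (by
    rw [← sq]; omega)
  rcases abs_choice m with h' | h'
  · exact ⟨l1, l2, hl, h' ▸ h⟩
  · exact ⟨-l1, -l2, by simpa using hl, by linarith⟩

/-- **Proposition 10.** For positive integers `s` and `n` with `2 ≤ n ≤ 2s² + 2s + 1`, the set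
`{s, s+1}` is an `s`-spanning set of size 2 in `ℤ_n`: the images of `s` and `s+1` in `ℤ_n` are
distinct, and every `g ∈ ℤ_n` is `λ₁ • s + λ₂ • (s+1)` for some integers `λ₁, λ₂` with
`|λ₁| + |λ₂| ≤ s`. -/
theorem spanning_pair_s_succ_s (s n : ℕ) (hs : 0 < s) (hn : 2 ≤ n)
    (hn' : n ≤ 2 * s ^ 2 + 2 * s + 1) :
    ((s : ZMod n) ≠ (s : ZMod n) + 1) ∧
    ∀ g : ZMod n, ∃ l1 l2 : ℤ, |l1| + |l2| ≤ (s : ℤ) ∧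
      g = l1 • (s : ZMod n) + l2 • ((s : ZMod n) + 1) := by
  constructor
  · intro h
    have : Fact (1 < n) := ⟨hn⟩
    exact one_ne_zero (left_eq_add.mp h)
  · intro g
    have : NeZero n := ⟨by omega⟩
    have hlt := g.val_lt
    obtain ⟨m, hm, hg⟩ : ∃ m : ℤ, |m| ≤ (s : ℤ) ^ 2 + s ∧ (m : ZMod n) = g := by
      zify at hn' hlt
      by_cases h : (g.val : ℤ) ≤ (s : ℤ) ^ 2 + s
      · exact ⟨g.val, by rwa [Nat.abs_cast], by simp⟩
      · exact ⟨g.val - n, abs_le.mpr ⟨by linarith, by linarith [sq_nonneg (s : ℤ)]⟩, by simp⟩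
    obtain ⟨l1, l2, hl, h⟩ := exists_combination_of_abs_le s m hm
    refine ⟨l1, l2, hl, ?_⟩
    rw [← hg, h]
    push_cast
    simp only [zsmul_eq_mul]
end

section
/- Let s be a positive integer. Then every element (a,b) of the group \mathbb{Z}_s \times \mathbb{Z}_{2s} can be written as (a,b) = \lambda_1 \cdot (0,1) + \lambda_2 \cdot (1,1) for some integers \lambda_1, \lambda_2 with |\lambda_1| + |\lambda_2| \le s; in other words, {(0,1),(1,1)} is an s-spanning set of \mathbb{Z}_s \times \mathbb{Z}_{2s}. -/
/-- Every integer is congruent modulo `2 * s` to one of absolute value at most `s`. -/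
theorem Int.exists_abs_sub_two_mul_le {s : ℤ} (hs : 0 < s) (n : ℤ) :
    ∃ k : ℤ, |n - 2 * s * k| ≤ s := by
  refine ⟨(n + s) / (2 * s), abs_le.2 ?_⟩
  have h := Int.mul_ediv_add_emod (n + s) (2 * s)
  have h0 := Int.emod_nonneg (n + s) (by lia : 2 * s ≠ 0)
  have h1 := Int.emod_lt_of_pos (n + s) (by lia : 0 < 2 * s)
  constructor <;> linarith

/-- The `ℓ¹` norm on `ℤ²` is the sup norm of the sum and difference of the coordinates. -/
theorem Int.abs_add_abs_le {x y c : ℤ} (hadd : |x + y| ≤ c) (hsub : |x - y| ≤ c) :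
    |x| + |y| ≤ c := by
  grind


/-- **Proposition 11.** For every positive integer `s`, the set `{(0,1),(1,1)}` is an
`s`-spanning set in `ℤ_s × ℤ_{2s}`: every element `(a,b)` is
`λ₁ • (0,1) + λ₂ • (1,1)` with `|λ₁| + |λ₂| ≤ s`. -/
theorem spanning_pair_Zs_Z2s (s : ℕ) (hs : 0 < s) :
    ∀ g : ZMod s × ZMod (2 * s), ∃ l1 l2 : ℤ, |l1| + |l2| ≤ (s : ℤ) ∧
      g = l1 • ((0 : ZMod s), (1 : ZMod (2 * s))) +
          l2 • ((1 : ZMod s), (1 : ZMod (2 * s))) := by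
  rintro ⟨a, b⟩
  obtain ⟨A, rfl⟩ := ZMod.intCast_surjective a
  obtain ⟨B, rfl⟩ := ZMod.intCast_surjective b
  have hs' : (0 : ℤ) < s := by exact_mod_cast hs
  obtain ⟨k, hk⟩ := Int.exists_abs_sub_two_mul_le hs' B
  obtain ⟨m, hm⟩ := Int.exists_abs_sub_two_mul_le hs' (B - 2 * s * k - 2 * A)
  refine ⟨B - 2 * s * k - (A + s * m), A + s * m,
    Int.abs_add_abs_le (by simpa using hk) (by convert hm using 2; ring), ?_⟩
  have h : (2 * s : ZMod (2 * s)) = 0 := by exact_mod_cast ZMod.natCast_self (2 * s)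
  ext
  · simp
  · simp [h]
end

section
/- Let s \ge 2 be an integer. Then the group G = \mathbb{Z}_s \times \mathbb{Z}_{2s} is a noncyclic finite abelian group of order 2s^2 that contains an s-spanning set of size 2 (namely {(0,1),(1,1)}). Consequently, for every integer s \ge 2 there exists a noncyclic finite abelian group of order 2s^2 possessing an s-spanning set of size 2. -/
theorem not_isAddCyclic_zmod_prod_zmod_two_mul {s : ℕ} (hs : 2 ≤ s) :
    ¬ IsAddCyclic (ZMod s × ZMod (2 * s)) := by
  intro h
  have hcard : Nat.card (ZMod s × ZMod (2 * s)) = s * (2 * s) := by simp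
  have hexp : AddMonoid.exponent (ZMod s × ZMod (2 * s)) ∣ 2 * s := by
    refine AddMonoid.exponent_dvd_of_forall_nsmul_eq_zero fun g => ?_
    ext
    · simp
    · rw [Prod.smul_snd, nsmul_eq_mul, ZMod.natCast_self, zero_mul, Prod.snd_zero]
  rw [IsAddCyclic.exponent_eq_card, hcard] at hexp
  have := Nat.le_of_dvd (by omega) hexp
  nlinarith

/-- Choose the residue `u` of `y` in `(-s, s]`, then the lift `l` of `x` with `|u - 2 * l| ≤ s`;
the coefficients `u - l` and `l` work because `|u - l| + |l| = max |u| |u - 2 * l|`. -/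
theorem exists_zsmul_add_zsmul_zmod_prod_zmod_two_mul {s : ℕ} (hs : 0 < s)
    (g : ZMod s × ZMod (2 * s)) :
    ∃ l1 l2 : ℤ, |l1| + |l2| ≤ (s : ℤ) ∧
      g = l1 • ((0 : ZMod s), (1 : ZMod (2 * s))) +
          l2 • ((1 : ZMod s), (1 : ZMod (2 * s))) := by
  obtain ⟨x, y⟩ := g
  have : NeZero s := ⟨by omega⟩
  have : NeZero (2 * s) := ⟨by omega⟩
  obtain ⟨u, hu, hul, hur⟩ : ∃ u : ℤ, (u : ZMod (2 * s)) = y ∧ -(s : ℤ) ≤ u ∧ u ≤ s := by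
    have hy := ZMod.val_lt y
    by_cases h : y.val ≤ s
    · exact ⟨y.val, by simp, by omega, by omega⟩
    · refine ⟨y.val - (2 * s : ℕ), ?_, by omega, by omega⟩
      rw [Int.cast_sub, Int.cast_natCast, Int.cast_natCast, ZMod.natCast_self]
      simp
  obtain ⟨l, hl, hll, hlr⟩ :
      ∃ l : ℤ, (l : ZMod s) = x ∧ u - s ≤ 2 * l ∧ 2 * l ≤ u + s := by
    have hx := ZMod.val_lt x
    by_cases h : 2 * (x.val : ℤ) ≤ u + s
    · exact ⟨x.val, by simp, by omega, h⟩
    · exact ⟨x.val - s, by simp, by omega, by omega⟩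
  refine ⟨u - l, l, ?_, ?_⟩
  · rcases abs_cases (u - l) with ⟨h, _⟩ | ⟨h, _⟩ <;>
      rcases abs_cases l with ⟨h', _⟩ | ⟨h', _⟩ <;> omega
  · ext
    · simp [hl]
    · simp [hu]


/-- **Lower bound `2s²` for noncyclic groups.** For every integer `s ≥ 2`, the group
`G = ℤ_s × ℤ_{2s}` is a noncyclic finite abelian group of order `2s²` in which
`{(0,1),(1,1)}` is an `s`-spanning set of size 2; consequently there exists a noncyclic
finite abelian group of order `2s²` having an `s`-spanning set of size 2. -/
theorem noncyclic_order_two_s_sq (s : ℕ) (hs : 2 ≤ s) :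
    (¬ IsAddCyclic (ZMod s × ZMod (2 * s)) ∧
      Nat.card (ZMod s × ZMod (2 * s)) = 2 * s ^ 2 ∧
      ((0 : ZMod s), (1 : ZMod (2 * s))) ≠ ((1 : ZMod s), (1 : ZMod (2 * s))) ∧
      ∀ g : ZMod s × ZMod (2 * s), ∃ l1 l2 : ℤ, |l1| + |l2| ≤ (s : ℤ) ∧
        g = l1 • ((0 : ZMod s), (1 : ZMod (2 * s))) +
            l2 • ((1 : ZMod s), (1 : ZMod (2 * s)))) ∧
    ∃ (G : Type) (_ : AddCommGroup G) (_ : Finite G), ¬ IsAddCyclic G ∧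
      Nat.card G = 2 * s ^ 2 ∧
      ∃ a b : G, a ≠ b ∧ ∀ g : G, ∃ l1 l2 : ℤ, |l1| + |l2| ≤ (s : ℤ) ∧
        g = l1 • a + l2 • b := by
  have hcyc := not_isAddCyclic_zmod_prod_zmod_two_mul hs
  have hcard : Nat.card (ZMod s × ZMod (2 * s)) = 2 * s ^ 2 := by
    simp only [Nat.card_prod, Nat.card_zmod]
    ring
  have hne : ((0 : ZMod s), (1 : ZMod (2 * s))) ≠ ((1 : ZMod s), (1 : ZMod (2 * s))) := by
    have : Fact (1 < s) := ⟨hs⟩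
    simp
  have hspan := exists_zsmul_add_zsmul_zmod_prod_zmod_two_mul (s := s) (by omega)
  have hfin : Finite (ZMod s × ZMod (2 * s)) :=
    Nat.finite_of_card_ne_zero (by rw [hcard]; positivity)
  exact ⟨⟨hcyc, hcard, hne, hspan⟩, _, inferInstance, hfin, hcyc, hcard, _, _, hne, hspan⟩
end

section
/- Let s be a positive integer such that 2s+1 is composite, let p be a prime divisor of 2s+1 with p < 2s+1, write 2s+1 = pt, and let k = (t^2-1)/2. Then \mathbb{Z}_p \times \mathbb{Z}_{pk} is a noncyclic finite abelian group of order 2s^2 + 2s - (p^2-1)/2 that contains an s-spanning set of size 2. Consequently, there exists a noncyclic finite abelian group of order at least 2s^2 + 2s - (p^2-1)/2 possessing an s-spanning set of size 2. -/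
/-- The translates of the square `[-s, s]²` by the lattice generated by `(2s + 1, d)` and
`(d, 2s + 1)` cover the integer plane when `0 ≤ d ≤ 2s`. -/
lemma exists_lattice_translate_mem_square (s d U V : ℤ) (hd : 0 ≤ d) (hds : d ≤ 2 * s) :
    ∃ i j : ℤ, |U - (2 * s + 1) * i - d * j| ≤ s ∧ |V - d * i - (2 * s + 1) * j| ≤ s := by
  have hN : 0 < 2 * s + 1 := by omega
  have hround : ∀ j : ℤ, ∃ i : ℤ, |U - (2 * s + 1) * i - d * j| ≤ s := fun j => by
    refine ⟨(U - d * j + s) / (2 * s + 1), abs_le.2 ?_⟩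
    have h₁ := Int.emod_nonneg (U - d * j + s) hN.ne'
    have h₂ := Int.emod_lt_of_pos (U - d * j + s) hN
    have h₃ := Int.mul_ediv_add_emod (U - d * j + s) (2 * s + 1)
    constructor <;> linarith
  choose i hi using hround
  have hstep : ∀ j, i (j + 1) ≤ i j ∧ i j ≤ i (j + 1) + 1 := fun j => by
    have h₁ := abs_le.1 (hi j)
    have h₂ := abs_le.1 (hi (j + 1))
    have h₃ : (2 * s + 1) * (i (j + 1) - i j) < (2 * s + 1) * 1 := by linarith
    have h₄ : (2 * s + 1) * (i j - i (j + 1)) < (2 * s + 1) * 2 := by linarith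
    have h₅ := lt_of_mul_lt_mul_left h₃ hN.le
    have h₆ := lt_of_mul_lt_mul_left h₄ hN.le
    omega
  obtain ⟨f, hf⟩ : ∃ f : ℤ → ℤ, ∀ j, f j = V - d * i j - (2 * s + 1) * j := ⟨_, fun _ => rfl⟩
  have hfstep : ∀ j, f (j + 1) + 1 ≤ f j ∧ f j ≤ f (j + 1) + (2 * s + 1) := fun j => by
    have h := hstep j
    rw [hf, hf]
    constructor <;> nlinarith
  have hanti : ∀ (j : ℤ) (n : ℕ), f (j + n) + n ≤ f j := fun j n => by
    induction n with
    | zero => simp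
    | succ n ih =>
      have h := (hfstep (j + n)).1
      push_cast
      rw [← add_assoc, ← add_assoc]
      linarith
  obtain ⟨j, hj, hmax⟩ := Int.exists_greatest_of_bdd (P := fun j => -s ≤ f j)
    ⟨(f 0 + s).toNat, fun z hz => by
      by_contra! hlt
      have h := hanti 0 z.toNat
      rw [zero_add, Int.toNat_of_nonneg (by omega)] at h
      omega⟩
    ⟨-((-s - f 0).toNat : ℤ), by
      have h := hanti (-((-s - f 0).toNat : ℤ)) (-s - f 0).toNat
      rw [neg_add_cancel] at h
      omega⟩
  refine ⟨i j, j, hi j, ?_⟩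
  rw [← hf, abs_le]
  refine ⟨hj, ?_⟩
  by_contra! hlt
  have h := hmax (j + 1) (by linarith [(hfstep j).2])
  omega

/-- When `2s + 1 = p(2r + 1)`, the elements `(1, r)` and `(1, r + 1)` form an `s`-spanning set of
`ℤ_p × ℤ_{2pr(r + 1)}`. -/
lemma exists_zsmul_add_zsmul_eq (p r s : ℕ) (hp : 0 < p) (hr : 0 < r)
    (h : 2 * s + 1 = p * (2 * r + 1)) (g : ZMod p × ZMod (p * (2 * r * (r + 1)))) :
    ∃ l₁ l₂ : ℤ, |l₁| + |l₂| ≤ (s : ℤ) ∧ g = l₁ • ((1 : ZMod p), (r : ZMod _)) +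
      l₂ • ((1 : ZMod p), ((r + 1 : ℕ) : ZMod _)) := by
  obtain ⟨u, hu⟩ := ZMod.intCast_surjective g.1
  obtain ⟨w, hw⟩ := ZMod.intCast_surjective g.2
  have hz : 2 * (s : ℤ) + 1 = p * (2 * r + 1) := by exact_mod_cast h
  have hps : (p : ℤ) ≤ 2 * s := by nlinarith
  obtain ⟨i, j, hi, hj⟩ := exists_lattice_translate_mem_square s p u
    ((2 * r + 1) * u - 2 * w) (by omega) hps
  refine ⟨(r + 1) * u - w - p * (r + 1) * (i + j), w - r * u - p * r * (i - j), ?_, ?_⟩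
  · rw [hz] at hi hj
    have hi := abs_le.1 hi
    have hj := abs_le.1 hj
    rcases abs_cases ((r + 1) * u - w - p * (r + 1) * (i + j) : ℤ) with ⟨h₁, -⟩ | ⟨h₁, -⟩ <;>
    rcases abs_cases (w - r * u - p * r * (i - j) : ℤ) with ⟨h₂, -⟩ | ⟨h₂, -⟩ <;>
    rw [h₁, h₂] <;> linarith
  · have hp0 : (p : ZMod p) = 0 := ZMod.natCast_self p
    have hk0 : (p : ZMod (p * (2 * r * (r + 1)))) * (2 * r * (r + 1)) = 0 := by
      exact_mod_cast ZMod.natCast_self (p * (2 * r * (r + 1)))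
    ext
    · simp only [Prod.fst_add, Prod.smul_mk, zsmul_eq_mul]
      rw [← hu]
      push_cast
      linear_combination ((r + 1) * (i + j) + r * (i - j) : ZMod p) * hp0
    · simp only [Prod.snd_add, Prod.smul_mk, zsmul_eq_mul]
      rw [← hw]
      push_cast
      linear_combination (i : ZMod (p * (2 * r * (r + 1)))) * hk0

lemma not_isAddCyclic_zmod_prod_zmod_mul (p k : ℕ) [NeZero p] [NeZero k] (hp : 1 < p) :
    ¬ IsAddCyclic (ZMod p × ZMod (p * k)) := fun h => by
  have := coprime_card_of_isAddCyclic_prod (ZMod p) (ZMod (p * k))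
  rw [Nat.card_zmod, Nat.card_zmod] at this
  exact hp.ne' (Nat.Coprime.eq_one_of_dvd this (dvd_mul_right p k))


/-- **Corollary 13.** Let `s` be a positive integer with `2s + 1` composite, let `p` be a prime
divisor of `2s + 1` with `p < 2s + 1`, write `2s + 1 = p * t`, and let `k = (t² - 1)/2`. Then
`ℤ_p × ℤ_{pk}` is a noncyclic finite abelian group of order `2s² + 2s - (p² - 1)/2` having an
`s`-spanning set of size 2; consequently there is a noncyclic finite abelian group of order at
least `2s² + 2s - (p² - 1)/2` having an `s`-spanning set of size 2. -/
theorem noncyclic_lower_bound_composite (s p t k : ℕ) (hs : 0 < s)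
    (hcomp : ¬ (2 * s + 1).Prime) (hp : p.Prime) (hplt : p < 2 * s + 1)
    (ht : 2 * s + 1 = p * t) (hk : k = (t ^ 2 - 1) / 2) :
    (¬ IsAddCyclic (ZMod p × ZMod (p * k)) ∧
      Nat.card (ZMod p × ZMod (p * k)) = 2 * s ^ 2 + 2 * s - (p ^ 2 - 1) / 2 ∧
      ∃ a b : ZMod p × ZMod (p * k), a ≠ b ∧
        ∀ g : ZMod p × ZMod (p * k), ∃ l1 l2 : ℤ, |l1| + |l2| ≤ (s : ℤ) ∧
          g = l1 • a + l2 • b) ∧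
    ∃ (G : Type) (_ : AddCommGroup G) (_ : Finite G), ¬ IsAddCyclic G ∧
      2 * s ^ 2 + 2 * s - (p ^ 2 - 1) / 2 ≤ Nat.card G ∧
      ∃ a b : G, a ≠ b ∧ ∀ g : G, ∃ l1 l2 : ℤ, |l1| + |l2| ≤ (s : ℤ) ∧
        g = l1 • a + l2 • b := by
  obtain ⟨r, rfl⟩ : Odd t := (Nat.odd_mul.1 (ht ▸ odd_two_mul_add_one s)).2
  obtain ⟨q, hq⟩ : Odd p := (Nat.odd_mul.1 (ht ▸ odd_two_mul_add_one s)).1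
  have hr : 0 < r := Nat.pos_of_ne_zero fun h => by
    subst h
    omega
  obtain rfl : k = 2 * r * (r + 1) := by
    rw [hk, show (2 * r + 1) ^ 2 - 1 = 2 * (2 * r * (r + 1)) from Nat.sub_eq_of_eq_add (by ring)]
    omega
  have hk2 : 1 < p * (2 * r * (r + 1)) := by nlinarith [hp.two_le, Nat.mul_pos hr hr]
  have : NeZero p := ⟨hp.ne_zero⟩
  have : NeZero (2 * r * (r + 1)) := ⟨by positivity⟩
  have hcyc := not_isAddCyclic_zmod_prod_zmod_mul p (2 * r * (r + 1)) hp.one_lt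
  have hcard : Nat.card (ZMod p × ZMod (p * (2 * r * (r + 1)))) =
      2 * s ^ 2 + 2 * s - (p ^ 2 - 1) / 2 := by
    rw [Nat.card_prod, Nat.card_zmod, Nat.card_zmod]
    have hp2 : (p ^ 2 - 1) / 2 = 2 * q * (q + 1) := by
      rw [hq, show (2 * q + 1) ^ 2 - 1 = 2 * (2 * q * (q + 1)) from Nat.sub_eq_of_eq_add (by ring)]
      omega
    rw [hp2]
    refine (Nat.sub_eq_of_eq_add ?_).symm
    obtain rfl : s = p * r + q := by linarith
    rw [hq]
    ring
  have hspan : ∃ a b : ZMod p × ZMod (p * (2 * r * (r + 1))), a ≠ b ∧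
      ∀ g : ZMod p × ZMod (p * (2 * r * (r + 1))), ∃ l1 l2 : ℤ, |l1| + |l2| ≤ (s : ℤ) ∧
        g = l1 • a + l2 • b := by
    refine ⟨_, _, fun h => ?_, exists_zsmul_add_zsmul_eq p r s hp.pos hr ht⟩
    have : Fact (1 < p * (2 * r * (r + 1))) := ⟨hk2⟩
    have h₂ := congrArg Prod.snd h
    push_cast at h₂
    exact one_ne_zero (left_eq_add.1 h₂)
  exact ⟨⟨hcyc, hcard, hspan⟩, _, inferInstance, inferInstance, hcyc, hcard.ge, hspan⟩
end

section
/- Let c be an odd prime, let k and s be positive integers, and let G = \mathbb{Z}_c \times \mathbb{Z}_{ck}. If G contains an s-spanning set of size 2, then G is s-regular; that is, there exist u, v \in \mathbb{Z}_{ck} such that every element g of G can be written as g = \lambda_1 \cdot (1,u) + \lambda_2 \cdot (1,v) for some integers \lambda_1, \lambda_2 with |\lambda_1| + |\lambda_2| \le s. -/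
/-- If `{a, b}` spans `ℤ_c × ℤ_{ck}` with coefficient weight at most `s`, and some character
`(x, y) ↦ α x + β y` with `α ≠ 0` takes the values `1` at `a` and `ε = ±1` at `b`, then
`{(1, a.2), (1, ε b.2)}` spans as well. -/
theorem spanning_normalize {c k s : ℕ} [Fact c.Prime] (π : ZMod (c * k) →+* ZMod c)
    {a b : ZMod c × ZMod (c * k)}
    (hspan : ∀ g : ZMod c × ZMod (c * k), ∃ l1 l2 : ℤ, |l1| + |l2| ≤ (s : ℤ) ∧
      g = l1 • a + l2 • b)
    {ε : ℤ} (hε : ε * ε = 1) (habs : |ε| = 1) {α β : ZMod c} (hα : α ≠ 0)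
    (ha : α * a.1 + β * π a.2 = 1) (hb : α * b.1 + β * π b.2 = ε) :
    ∃ u v : ZMod (c * k), ∀ g : ZMod c × ZMod (c * k), ∃ l1 l2 : ℤ,
      |l1| + |l2| ≤ (s : ℤ) ∧
      g = l1 • ((1 : ZMod c), u) + l2 • ((1 : ZMod c), v) := by
  refine ⟨a.2, ε • b.2, fun ⟨x, y⟩ => ?_⟩
  obtain ⟨l1, l2, hl, hg⟩ := hspan (α⁻¹ * (x - β * π y), y)
  have h1 := congrArg Prod.fst hg
  have h2 := congrArg Prod.snd hg
  simp only [Prod.fst_add, Prod.snd_add, zsmul_eq_mul, Prod.fst_mul, Prod.snd_mul,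
      Prod.fst_intCast, Prod.snd_intCast] at h1 h2
  have hπ : π y = l1 * π a.2 + l2 * π b.2 := by rw [h2]; simp
  have hx : α * (α⁻¹ * (x - β * π y)) = x - β * π y := mul_inv_cancel_left₀ hα _
  refine ⟨l1, l2 * ε, by rwa [abs_mul, habs, mul_one], Prod.ext ?_ ?_⟩
  · simp only [Prod.fst_add, zsmul_eq_mul, Prod.fst_mul, Prod.fst_intCast, mul_one,
      Int.cast_mul]
    linear_combination -hx + α * h1 + β * hπ + l1 * ha + l2 * hb
  · have hε' : (ε : ZMod (c * k)) * ε = 1 := by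
      rw [← Int.cast_mul, hε, Int.cast_one]
    simp only [Prod.snd_add, zsmul_eq_mul, Prod.snd_mul, Prod.snd_intCast, Int.cast_mul]
    linear_combination h2 - l2 * b.2 * hε'


/-- **Theorem 14.** Let `c` be an odd prime and `k, s` positive integers. If
`G = ℤ_c × ℤ_{ck}` has an `s`-spanning set of size 2, then `G` is `s`-regular: there exist
`u, v ∈ ℤ_{ck}` such that every `g ∈ G` is `λ₁ • (1,u) + λ₂ • (1,v)` with `|λ₁| + |λ₂| ≤ s`. -/
theorem s_regular_of_spanning_odd_prime (c k s : ℕ) (hc : c.Prime) (hodd : Odd c)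
    (hk : 0 < k) (hs : 0 < s)
    (hspan : ∃ a b : ZMod c × ZMod (c * k), a ≠ b ∧
      ∀ g : ZMod c × ZMod (c * k), ∃ l1 l2 : ℤ, |l1| + |l2| ≤ (s : ℤ) ∧
        g = l1 • a + l2 • b) :
    ∃ u v : ZMod (c * k), ∀ g : ZMod c × ZMod (c * k), ∃ l1 l2 : ℤ,
      |l1| + |l2| ≤ (s : ℤ) ∧
      g = l1 • ((1 : ZMod c), u) + l2 • ((1 : ZMod c), v) := by
  obtain ⟨a, b, -, hspan⟩ := hspan
  have : Fact c.Prime := ⟨hc⟩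
  let π : ZMod (c * k) →+* ZMod c := ZMod.castHom (dvd_mul_right c k) (ZMod c)
  have hD : a.1 * π b.2 - b.1 * π a.2 ≠ 0 := by
    obtain ⟨l1, l2, -, hl⟩ := hspan (1, 0)
    obtain ⟨m1, m2, -, hm⟩ := hspan (0, 1)
    have hl1 := congrArg Prod.fst hl
    have hl2 := congrArg (fun g => π g.2) hl
    have hm1 := congrArg Prod.fst hm
    have hm2 := congrArg (fun g => π g.2) hm
    simp only [Prod.fst_add, Prod.snd_add, zsmul_eq_mul, Prod.fst_mul, Prod.snd_mul,
      Prod.fst_intCast, Prod.snd_intCast, map_add, map_mul, map_intCast, map_zero, map_one] at hl1 hl2 hm1 hm2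
    intro hD
    refine one_ne_zero (α := ZMod c) ?_
    linear_combination hl1 + (l1 * a.1 + l2 * b.1) * hm2 - (l1 * π a.2 + l2 * π b.2) * hm1
      + (l1 * m2 - l2 * m1) * hD
  have key (ε : ℤ) (hε : ε * ε = 1) (habs : |ε| = 1) (h : π b.2 - ε * π a.2 ≠ 0) :=
    spanning_normalize π hspan hε habs
      (α := (π b.2 - ε * π a.2) / (a.1 * π b.2 - b.1 * π a.2))
      (β := (ε * a.1 - b.1) / (a.1 * π b.2 - b.1 * π a.2))
      (div_ne_zero h hD) (by rw [div_mul_eq_mul_div, div_mul_eq_mul_div, ← add_div, div_eq_iff hD]; ring)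
      (by rw [div_mul_eq_mul_div, div_mul_eq_mul_div, ← add_div, div_eq_iff hD]; ring)
  by_cases hminus : π b.2 - (1 : ℤ) * π a.2 = 0
  · refine key (-1) (by norm_num) (by norm_num) fun hplus => hD ?_
    push_cast at hminus hplus
    have h2 : (2 : ZMod c) ≠ 0 := by
      have : Fact (2 < c) := ⟨by
        have := hc.two_le
        obtain ⟨m, rfl⟩ := hodd
        omega⟩
      exact Ring.two_ne_zero (by rw [ZMod.ringChar_zmod_n]; exact (Fact.out : 2 < c).ne')
    have hb : π b.2 = 0 := (mul_eq_zero.mp (by linear_combination hminus + hplus :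
      (2 : ZMod c) * π b.2 = 0)).resolve_left h2
    have ha : π a.2 = 0 := by linear_combination hb - hminus
    rw [ha, hb]; ring
  · exact key 1 (by norm_num) (by norm_num) hminus
end

section
/- Let s be a positive integer and let c \ge 2 and k \ge 1 be integers with c even, and suppose the group G = \mathbb{Z}_c \times \mathbb{Z}_{ck} is s-regular. Then |G| = c^2 k \le 2s^2, and if c^2 k = 2s^2 then s is divisible by c. -/
/-- The group `ℤ_c × ℤ_{ck}` is `s`-regular: it has an `s`-spanning set of the form
`{(1,u),(1,v)}`, i.e. there are `u, v ∈ ℤ_{ck}` such that every element `g` is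
`λ₁ • (1,u) + λ₂ • (1,v)` for some integers `λ₁, λ₂` with `|λ₁| + |λ₂| ≤ s`. -/
def SRegular (c k s : ℕ) : Prop :=
  ∃ u v : ZMod (c * k), ∀ g : ZMod c × ZMod (c * k), ∃ l1 l2 : ℤ,
    |l1| + |l2| ≤ (s : ℤ) ∧
    g = l1 • ((1 : ZMod c), u) + l2 • ((1 : ZMod c), v)

/-- Integers of parity opposite to `s` with `|l1| + |l2| ≤ s` come from the grid `Fin s × Fin s`. -/
lemma exists_fin_coords {s : ℕ} {l1 l2 : ℤ} (h : |l1| + |l2| ≤ (s : ℤ))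
    (hodd : (l1 + l2 - s) % 2 = 1) :
    ∃ a b : Fin s, l1 = (a : ℤ) + b - (s - 1) ∧ l2 = (a : ℤ) - b := by
  have h1 := le_abs_self l1
  have h2 := le_abs_self l2
  have h3 := neg_abs_le l1
  have h4 := neg_abs_le l2
  refine ⟨⟨((l1 + l2 + s - 1) / 2).toNat, by omega⟩,
    ⟨((l1 - l2 + s - 1) / 2).toNat, by omega⟩, ?_, ?_⟩ <;> simp only <;> omega

lemma SRegular.card_le {s c k : ℕ} (hc : c ≠ 0) (hk : k ≠ 0) (hce : Even c)
    (hreg : SRegular c k s) : c ^ 2 * k ≤ 2 * s ^ 2 := by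
  obtain ⟨u, v, h⟩ := hreg
  have : NeZero c := ⟨hc⟩
  have : NeZero (c * k) := ⟨Nat.mul_ne_zero hc hk⟩
  let f : (Fin s × Fin s) × Fin 2 → ZMod c × ZMod (c * k) := fun p =>
    ((p.1.1 : ℤ) + p.1.2 - (s - 1)) • ((1 : ZMod c), u) +
      ((p.1.1 : ℤ) - p.1.2) • ((1 : ZMod c), v) + (p.2 : ℕ) • ((1 : ZMod c), (0 : ZMod (c * k)))
  have hf : Function.Surjective f := by
    intro g
    obtain ⟨l1, l2, hl, hg⟩ := h g
    by_cases hodd : (l1 + l2 - s) % 2 = 1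
    · obtain ⟨a, b, rfl, rfl⟩ := exists_fin_coords hl hodd
      exact ⟨((a, b), 0), by simp [f, hg]⟩
    · obtain ⟨m1, m2, hm, hg'⟩ := h (g - (1, 0))
      have hmod : ((m1 + m2 + 1 - (l1 + l2) : ℤ) : ZMod c) = 0 := by
        have e := congrArg Prod.fst hg
        have e' := congrArg Prod.fst hg'
        simp only [Prod.fst_sub, Prod.fst_add, Prod.smul_fst, zsmul_one] at e e'
        push_cast
        rw [← e, ← e']
        ring
      have hdvd : (2 : ℤ) ∣ m1 + m2 + 1 - (l1 + l2) :=
        (Int.natCast_dvd_natCast.mpr hce.two_dvd).trans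
          ((ZMod.intCast_zmod_eq_zero_iff_dvd _ c).mp hmod)
      obtain ⟨a, b, rfl, rfl⟩ := exists_fin_coords hm (by omega)
      exact ⟨((a, b), 1), by simp only [f, ← hg']; simp⟩
  have := Fintype.card_le_of_surjective f hf
  simp only [Fintype.card_prod, ZMod.card, Fintype.card_fin] at this
  linarith

lemma Even.dvd_of_sq_mul_eq_two_mul_sq {c k s : ℕ} (hc : c ≠ 0) (hce : Even c)
    (h : c ^ 2 * k = 2 * s ^ 2) : c ∣ s := by
  obtain ⟨d, rfl⟩ := hce.two_dvd
  have hd : 0 < d := by omega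
  have hs : s ^ 2 = d ^ 2 * (2 * k) := by linarith
  obtain ⟨n, rfl⟩ := (Nat.pow_dvd_pow_iff two_ne_zero).mp (Dvd.intro _ hs.symm)
  rw [mul_pow] at hs
  have hn : n ^ 2 = 2 * k := Nat.eq_of_mul_eq_mul_left (Nat.pow_pos hd) hs
  have h2 : 2 ∣ n := Nat.prime_two.dvd_of_dvd_pow (Dvd.intro _ hn.symm)
  rw [mul_comm 2 d]
  exact mul_dvd_mul_left d h2

/-- **Theorem 15(1).** If `c` is even and `ℤ_c × ℤ_{ck}` is `s`-regular, then its order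
`c²k` is at most `2s²`, and equality may occur only when `c ∣ s`. -/
theorem regular_even_bound (s c k : ℕ) (hs : 0 < s) (hc : 2 ≤ c) (hk : 1 ≤ k)
    (hce : Even c) (hreg : SRegular c k s) :
    c ^ 2 * k ≤ 2 * s ^ 2 ∧ (c ^ 2 * k = 2 * s ^ 2 → c ∣ s) :=
  ⟨hreg.card_le (by omega) (by omega) hce, hce.dvd_of_sq_mul_eq_two_mul_sq (by omega)⟩
end

section
/- Let s be a positive integer and let c \ge 2 and k \ge 1 be integers with c odd and s divisible by c, and suppose the group G = \mathbb{Z}_c \times \mathbb{Z}_{ck} is s-regular. Then |G| = c^2 k \le 2s^2 + s. -/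
/-- For `c` odd, an integer point `(a, b)` with `a + b = 1 + c * j` is determined by `a - b`
together with the index `(j + m) / 2` of the pair of consecutive integers containing `j + m`. -/
lemma eq_of_sub_eq_of_half_eq {c m a b j a' b' j' : ℤ} (hc : Odd c)
    (h : a + b = 1 + c * j) (h' : a' + b' = 1 + c * j') (hd : a - b = a' - b')
    (hj : (j + m) / 2 = (j' + m) / 2) : a = a' ∧ b = b' := by
  have hdiff : c * (j - j') = 2 * (a - a') := by linear_combination h' - h - hd
  have heven : Even (j - j') := by
    have : Even (c * (j - j')) := hdiff ▸ even_two_mul _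
    exact (Int.even_mul.mp this).resolve_left (Int.not_even_iff_odd.mpr hc)
  obtain ⟨r, hr⟩ := heven
  obtain rfl : j = j' := by omega
  constructor <;> linarith

/-- If `c ≥ 2` and `|a| + |b| ≤ c * m`, where `a + b = 1 + c * j`, then `-m ≤ j < m`. -/
lemma index_bounds {c m a b j : ℤ} (hc : 2 ≤ c) (hab : |a| + |b| ≤ c * m)
    (h : a + b = 1 + c * j) : -m ≤ j ∧ j < m := by
  obtain ⟨h1, h2⟩ := abs_le.mp ((abs_add_le a b).trans hab)
  constructor
  · by_contra! hlt
    nlinarith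
  · by_contra! hle
    nlinarith

/-- **Theorem 15(2), first case.** If `c` is odd, `c ∣ s`, and `ℤ_c × ℤ_{ck}` is
`s`-regular, then its order `c²k` is at most `2s² + s`. -/
theorem regular_odd_dvd_bound (s c k : ℕ) (hs : 0 < s) (hc : 2 ≤ c) (hk : 1 ≤ k)
    (hco : Odd c) (hdvd : c ∣ s) (hreg : SRegular c k s) :
    c ^ 2 * k ≤ 2 * s ^ 2 + s := by
  obtain ⟨u, v, huv⟩ := hreg
  obtain ⟨m, rfl⟩ := hdvd
  have : NeZero (c * k) := ⟨by positivity⟩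
  have key : ∀ h : ZMod (c * k), ∃ a b j : ℤ,
      |a| + |b| ≤ (c : ℤ) * m ∧ a + b = 1 + c * j ∧ h = a • u + b • v := by
    intro h
    obtain ⟨a, b, hab, hg⟩ := huv (1, h)
    have h1 : (1 : ZMod c) = a • 1 + b • 1 := congrArg Prod.fst hg
    have h2 : h = a • u + b • v := congrArg Prod.snd hg
    have h3 : ((1 : ℤ) : ZMod c) = ((a + b : ℤ) : ZMod c) := by simpa using h1
    obtain ⟨j, hj⟩ := (ZMod.intCast_eq_intCast_iff_dvd_sub _ _ _).mp h3
    exact ⟨a, b, j, by exact_mod_cast hab, by linarith, h2⟩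
  choose a b j hab hj hval using key
  have hcard : (Finset.univ : Finset (ZMod (c * k))).card ≤
      (Finset.Ico (0 : ℤ) m ×ˢ Finset.Icc (-(c * m : ℤ)) (c * m)).card := by
    refine Finset.card_le_card_of_injOn (fun h => ((j h + m) / 2, a h - b h)) ?_ ?_
    · intro h _
      have hb := index_bounds (by exact_mod_cast hc) (hab h) (hj h)
      have hd := abs_le.mp ((abs_sub (a h) (b h)).trans (hab h))
      simp only [Finset.coe_product, Set.mem_prod, Finset.coe_Ico, Finset.coe_Icc, Set.mem_Ico,
        Set.mem_Icc]
      exact ⟨by omega, hd⟩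
    · intro h _ h' _ heq
      obtain ⟨h1, h2⟩ := Prod.mk.inj heq
      obtain ⟨ha, hb⟩ := eq_of_sub_eq_of_half_eq (by exact_mod_cast hco) (hj h) (hj h') h2 h1
      rw [hval h, hval h', ha, hb]
  rw [Finset.card_univ, ZMod.card, Finset.card_product, Int.card_Ico, Int.card_Icc] at hcard
  have hwidth : ((c * m : ℤ) + 1 - -(c * m : ℤ)).toNat = 2 * (c * m) + 1 := by
    rw [← Nat.cast_mul]
    omega
  rw [hwidth, sub_zero, Int.toNat_natCast] at hcard
  nlinarith
end

section
/- Let s be a positive integer and let c \ge 2 and k \ge 1 be integers with c odd and s \equiv (c-1)/2 \pmod{c}, and suppose the group G = \mathbb{Z}_c \times \mathbb{Z}_{ck} is s-regular. Then |G| = c^2 k \le 2s^2 + 2s - (c^2-1)/2. -/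
/-- `s`-regularity expressed through integer divisibility. -/
lemma SRegular.exists_int {c k s : ℕ} (hreg : SRegular c k s) :
    ∃ u v : ℤ, ∀ a b : ℤ, ∃ l1 l2 : ℤ, |l1| + |l2| ≤ (s : ℤ) ∧
      (c : ℤ) ∣ l1 + l2 - a ∧ (c : ℤ) * k ∣ l1 * u + l2 * v - b := by
  obtain ⟨u, v, h⟩ := hreg
  obtain ⟨u, rfl⟩ := ZMod.intCast_surjective u
  obtain ⟨v, rfl⟩ := ZMod.intCast_surjective v
  refine ⟨u, v, fun a b ↦ ?_⟩
  obtain ⟨l1, l2, hl, he⟩ := h ((a : ZMod c), (b : ZMod (c * k)))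
  refine ⟨l1, l2, hl, ?_, ?_⟩
  · rw [← ZMod.intCast_eq_intCast_iff_dvd_sub]
    simpa using congrArg Prod.fst he
  · have := congrArg Prod.snd he
    rw [← Nat.cast_mul, ← ZMod.intCast_eq_intCast_iff_dvd_sub]
    simpa using this

/-- A point of the `ℓ¹`-ball of radius `q * c + h`, both of whose coordinates are congruent to `h`
modulo `c = 2 * h + 1`, lies in a diamond of radius `q` centred at a half-integral point. -/
lemma abs_le_of_abs_add_abs_le {c h q i j : ℤ} (hh : 1 ≤ h) (hc : c = 2 * h + 1)
    (hij : |h + c * i| + |h + c * j| ≤ q * c + h) : |i + j + 1| ≤ q ∧ |i - j| ≤ q := by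
  have h1 := le_abs_self (h + c * i)
  have h2 := neg_le_abs (h + c * i)
  have h3 := le_abs_self (h + c * j)
  have h4 := neg_le_abs (h + c * j)
  have key : ∀ x : ℤ, c * x < c * (q + 1) → x ≤ q := fun x hx ↦
    Int.lt_add_one_iff.mp (lt_of_mul_lt_mul_left hx (by omega))
  rw [abs_le', abs_le']
  refine ⟨⟨key _ ?_, key _ ?_⟩, ⟨key _ ?_, key _ ?_⟩⟩ <;> linarith

/-- The integer points of a diamond of radius `q` centred at `(-1/2, -1/2)` are numbered
injectively by `0, …, 2 * q * (q + 1) - 1`. -/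
lemma exists_injOn_diamond (q : ℤ) : ∃ f : ℤ × ℤ → ℤ,
    Set.MapsTo f {p | |p.1 + p.2 + 1| ≤ q ∧ |p.1 - p.2| ≤ q} (Set.Ico 0 (2 * q * (q + 1))) ∧
    Set.InjOn f {p | |p.1 + p.2 + 1| ≤ q ∧ |p.1 - p.2| ≤ q} := by
  refine ⟨fun p ↦ (p.1 + p.2 + 1) * q + p.1 + q * (q + 1), ?_, ?_⟩
  · rintro ⟨i, j⟩ ⟨h1, h2⟩
    simp only [abs_le, Set.mem_Ico] at h1 h2 ⊢
    constructor
    · have : 0 ≤ (i + j + 1 + q) * (2 * q + 1) := mul_nonneg (by omega) (by omega)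
      nlinarith
    · have : 0 ≤ (q - (i + j + 1)) * (2 * q + 1) := mul_nonneg (by omega) (by omega)
      nlinarith
  · rintro ⟨i, j⟩ ⟨h1, h2⟩ ⟨i', j'⟩ ⟨h3, h4⟩ he
    simp only [abs_le] at h1 h2 h3 h4 he
    have hd : (2 * q + 1) * ((i + j) - (i' + j')) = (i' - j') - (i - j) := by linarith
    have h0 : (i' - j') - (i - j) = 0 :=
      Int.eq_zero_of_abs_lt_dvd ⟨_, hd.symm⟩ (by rw [abs_lt]; omega)
    rw [h0] at hd
    have := (mul_eq_zero.mp hd).resolve_left (by omega)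
    ext <;> simp only <;> omega

lemma le_two_mul_of_forall_exists {c h q u v : ℤ} {k : ℕ} (hh : 1 ≤ h) (hc : c = 2 * h + 1)
    (H : ∀ a b : ℤ, ∃ l1 l2 : ℤ, |l1| + |l2| ≤ q * c + h ∧
      c ∣ l1 + l2 - a ∧ c * k ∣ l1 * u + l2 * v - b) :
    (k : ℤ) ≤ 2 * q * (q + 1) := by
  obtain ⟨m, n, -, ⟨x, hx⟩, ⟨y, hy⟩⟩ := H 0 1
  have hunit : IsCoprime c (v - u) := ⟨x * u - k * y, n, by linear_combination hy - u * hx⟩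
  have hrep : ∀ t : ℕ, ∃ p : ℤ × ℤ, (|p.1 + p.2 + 1| ≤ q ∧ |p.1 - p.2| ≤ q) ∧
      (k : ℤ) ∣ p.1 * u + p.2 * v - t := by
    intro t
    obtain ⟨l1, l2, hl, ⟨x, hx⟩, ⟨y, hy⟩⟩ := H (2 * h) (h * u + h * v + c * t)
    obtain ⟨j, hj⟩ : c ∣ l2 - h := hunit.dvd_of_dvd_mul_left
      ⟨k * y + t - x * u, by linear_combination hy - u * hx⟩
    have h1 : l1 = h + c * (x - j) := by linear_combination hx - hj
    have h2 : l2 = h + c * j := by linear_combination hj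
    refine ⟨(x - j, j), abs_le_of_abs_add_abs_le hh hc (by rwa [← h1, ← h2]), y, ?_⟩
    apply mul_left_cancel₀ (show c ≠ 0 by omega)
    rw [h1, h2] at hy
    linear_combination hy
  choose p hp hpt using hrep
  obtain ⟨f, hf, hinj⟩ := exists_injOn_diamond q
  have hcard : (Finset.range k).card ≤ (Finset.Ico 0 (2 * q * (q + 1))).card := by
    refine Finset.card_le_card_of_injOn (fun t ↦ f (p t))
      (fun t _ ↦ by simpa using hf (hp t)) fun t ht t' ht' he ↦ ?_
    simp only [Finset.coe_range, Set.mem_Iio] at ht ht'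
    have hpp : p t = p t' := hinj (hp t) (hp t') he
    have hd := dvd_sub (hpt t) (hpp ▸ hpt t')
    have := Int.eq_zero_of_abs_lt_dvd hd (by rw [abs_lt]; constructor <;> linarith)
    omega
  rw [Finset.card_range, Int.card_Ico] at hcard
  have : 0 ≤ 2 * q * (q + 1) := by
    rcases le_or_gt 0 q with h | h
    · positivity
    · nlinarith
  omega

/-- **Theorem 15(2), second case.** If `c` is odd, `s ≡ (c-1)/2 (mod c)`, and
`ℤ_c × ℤ_{ck}` is `s`-regular, then its order `c²k` is at most `2s² + 2s - (c²-1)/2`. -/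
theorem regular_odd_half_bound (s c k : ℕ) (hs : 0 < s) (hc : 2 ≤ c) (hk : 1 ≤ k)
    (hco : Odd c) (hmod : s % c = (c - 1) / 2) (hreg : SRegular c k s) :
    c ^ 2 * k ≤ 2 * s ^ 2 + 2 * s - (c ^ 2 - 1) / 2 := by
  obtain ⟨h, rfl⟩ := hco
  obtain ⟨u, v, H⟩ := hreg.exists_int
  have hsq : s = s / (2 * h + 1) * (2 * h + 1) + h := by
    have := Nat.div_add_mod' s (2 * h + 1)
    omega
  generalize s / (2 * h + 1) = q at hsq
  have hb : (k : ℤ) ≤ 2 * q * (q + 1) := by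
    refine le_two_mul_of_forall_exists (c := 2 * h + 1) (h := h) (u := u) (v := v)
      (by omega) rfl fun a b ↦ ?_
    simpa [hsq] using H a b
  have hb' : k ≤ 2 * q * (q + 1) := by exact_mod_cast hb
  have hc2 : ((2 * h + 1) ^ 2 - 1) / 2 = 2 * h ^ 2 + 2 * h := by
    have : (2 * h + 1) ^ 2 = 2 * (2 * h ^ 2 + 2 * h) + 1 := by ring
    omega
  rw [hc2]
  apply Nat.le_sub_of_add_le
  calc (2 * h + 1) ^ 2 * k + (2 * h ^ 2 + 2 * h)
      ≤ (2 * h + 1) ^ 2 * (2 * q * (q + 1)) + (2 * h ^ 2 + 2 * h) := by gcongr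
    _ = 2 * s ^ 2 + 2 * s := by rw [hsq]; ring
end

section
/- Let s be a positive integer with s \equiv 2 \pmod{3} and let k \ge 1 be an integer, and suppose the group G = \mathbb{Z}_3 \times \mathbb{Z}_{3k} is s-regular. Then |G| = 9k \le 2s^2 + 1. -/
/-- The points of the `ℓ¹`-ball of radius `3t + 2` in `ℤ²` whose coordinate sum is divisible by `3`,
parametrized along the antidiagonals `a + b = 3m` according to the parity of `t - m`. -/
def ballPoint (t : ℕ) :
    (Fin (t + 1) × Fin (3 * t + 3)) ⊕ (Fin t × Fin (3 * t + 2)) → ℤ × ℤ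
  | .inl (i, j) => (3 * t + 1 - 3 * i - j, j - 1 - 3 * i)
  | .inr (i, j) => (3 * t - 1 - 3 * i - j, j - 2 - 3 * i)

theorem exists_ballPoint_eq (t : ℕ) (a b : ℤ) (hab : |a| + |b| ≤ ((3 * t + 2 : ℕ) : ℤ))
    (hdvd : (3 : ℤ) ∣ a + b) : ∃ p, ballPoint t p = (a, b) := by
  obtain ⟨m, hm⟩ := hdvd
  have h₁ := le_abs_self a
  have h₂ := neg_abs_le a
  have h₃ := le_abs_self b
  have h₄ := neg_abs_le b
  push_cast at hab
  obtain h | h : (t - m) % 2 = 0 ∨ (t - m) % 2 = 1 := by omega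
  · refine ⟨.inl (⟨((t - m) / 2).toNat, by omega⟩, ⟨((3 * t + 2 - a + b) / 2).toNat, by omega⟩), ?_⟩
    ext <;> simp only [ballPoint] <;> omega
  · refine ⟨.inr (⟨((t - 1 - m) / 2).toNat, by omega⟩,
      ⟨((3 * t + 1 - a + b) / 2).toNat, by omega⟩), ?_⟩
    ext <;> simp only [ballPoint] <;> omega

/-- **Theorem 15(2), third case.** If `s ≡ 2 (mod 3)` and `ℤ_3 × ℤ_{3k}` is `s`-regular,
then its order `9k` is at most `2s² + 1`. -/
theorem regular_three_bound (s k : ℕ) (hs : 0 < s) (hk : 1 ≤ k)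
    (hmod : s % 3 = 2) (hreg : SRegular 3 k s) :
    9 * k ≤ 2 * s ^ 2 + 1 := by
  obtain ⟨t, rfl⟩ : ∃ t, s = 3 * t + 2 := ⟨s / 3, by omega⟩
  obtain ⟨u, v, huv⟩ := hreg
  have : NeZero (3 * k) := ⟨by omega⟩
  have hsurj : Function.Surjective
      (fun p ↦ (ballPoint t p).1 • u + (ballPoint t p).2 • v) := by
    intro x
    obtain ⟨a, b, hab, hx⟩ := huv (0, x)
    have hsum : ((a + b : ℤ) : ZMod 3) = 0 := by
      simpa using (congrArg Prod.fst hx).symm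
    obtain ⟨p, hp⟩ := exists_ballPoint_eq t a b hab
      (by exact_mod_cast (ZMod.intCast_zmod_eq_zero_iff_dvd (a + b) 3).mp hsum)
    exact ⟨p, by simpa [hp] using (congrArg Prod.snd hx).symm⟩
  have hcard := Fintype.card_le_of_surjective _ hsurj
  simp only [ZMod.card, Fintype.card_sum, Fintype.card_prod, Fintype.card_fin] at hcard
  nlinarith
end

section
/- Let s be a positive integer and let c \ge 2 and k \ge 1 be integers with c odd, and let r be the remainder of s upon division by c. Suppose r \ne 0, r \ne (c-1)/2, and it is not the case that c = 3 and r = 2. If the group G = \mathbb{Z}_c \times \mathbb{Z}_{ck} is s-regular, then |G| = c^2 k < 2s^2. -/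
/-- Counting the pairs `(l1, l2)` with `l1 + l2 ≡ i - s [ZMOD c]`: they lie on the lines
`l1 + l2 = i - s + j * c`, each of which contains `s` or `s + 1` points of the ball. -/
lemma SRegular.mul_le_sum {c k s : ℕ} (hc : 0 < c) (hk : 0 < k) (h : SRegular c k s)
    {i N : ℕ} (hi : i < c) (hN : 2 * s < i + N * c) :
    c * k ≤ ∑ j ∈ Finset.range N, (s + 1 - (i + j * c) % 2) := by
  classical
  obtain ⟨u, v, h⟩ := h
  have : NeZero (c * k) := ⟨(Nat.mul_pos hc hk).ne'⟩
  let S := (Finset.range N).sigma fun j => Finset.range (s + 1 - (i + j * c) % 2)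
  let f : (Σ _ : ℕ, ℕ) → ZMod (c * k) := fun p =>
    (((i + p.1 * c) / 2 : ℕ) - (p.2 : ℤ) : ℤ) • u +
      ((i + p.1 * c : ℕ) - (s : ℤ) - (((i + p.1 * c) / 2 : ℕ) - (p.2 : ℤ)) : ℤ) • v
  have hsurj : (Finset.univ : Finset (ZMod (c * k))) ⊆ S.image f := by
    intro x _
    obtain ⟨l1, l2, hl, hg⟩ := h ((((i : ℤ) - s : ℤ) : ZMod c), x)
    obtain ⟨h1, h2⟩ := Prod.ext_iff.1 hg
    simp only [Prod.fst_add, Prod.smul_fst, Prod.snd_add, Prod.smul_snd, zsmul_one] at h1 h2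
    rw [← Int.cast_add, ZMod.intCast_eq_intCast_iff_dvd_sub] at h1
    obtain ⟨j, hj⟩ := h1
    have hbounds : 0 ≤ l1 + l2 + s ∧ l1 + l2 + s ≤ 2 * s ∧ l1 - l2 ≤ s ∧ l2 - l1 ≤ s := by
      have := le_abs_self l1
      have := le_abs_self l2
      have := neg_abs_le l1
      have := neg_abs_le l2
      omega
    obtain ⟨hb0, hb1, hb2, hb3⟩ := hbounds
    have hj0 : 0 ≤ j := by
      by_contra hneg
      nlinarith
    lift j to ℕ using hj0
    have hm : ((i + j * c : ℕ) : ℤ) = l1 + l2 + s := by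
      push_cast
      linarith
    have hjN : j < N := by
      by_contra hle
      have : N * c ≤ j * c := Nat.mul_le_mul_right c (not_lt.1 hle)
      omega
    refine Finset.mem_image.2 ⟨⟨j, (((i + j * c) / 2 : ℕ) - l1 : ℤ).toNat⟩, ?_, ?_⟩
    · simp only [S, Finset.mem_sigma, Finset.mem_range]
      refine ⟨hjN, ?_⟩
      omega
    · have he : (((((i + j * c) / 2 : ℕ) - l1 : ℤ).toNat : ℕ) : ℤ) =
          ((i + j * c) / 2 : ℕ) - l1 := Int.toNat_of_nonneg (by omega)
      simp only [f]
      rw [he, hm, h2]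
      congr 2 <;> ring
  calc c * k = (Finset.univ : Finset (ZMod (c * k))).card := by
        rw [Finset.card_univ, ZMod.card]
    _ ≤ S.card := (Finset.card_le_card hsurj).trans Finset.card_image_le
    _ = _ := by simp [S, Finset.card_sigma]

lemma sum_range_two_mul_succ_sub_mod_two {c : ℕ} (hc : Odd c) (s i q : ℕ) :
    ∑ j ∈ Finset.range (2 * q), (s + 1 - (i + j * c) % 2) = q * (2 * s + 1) := by
  obtain ⟨b, rfl⟩ := hc
  have hmod (j : ℕ) : (i + j * (2 * b + 1)) % 2 = (i + j) % 2 := by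
    rw [show i + j * (2 * b + 1) = i + j + 2 * (j * b) by ring, Nat.add_mul_mod_self_left]
  simp only [hmod]
  induction q with
  | zero => simp
  | succ q ih =>
    rw [show 2 * (q + 1) = 2 * q + 1 + 1 by ring, Finset.sum_range_succ, Finset.sum_range_succ,
      ih, add_one_mul]
    omega


/-- **Theorem 15(2), remaining cases.** Let `c` be odd and `r = s % c`. If `r ≠ 0`,
`r ≠ (c-1)/2`, and not (`c = 3` and `r = 2`), and `ℤ_c × ℤ_{ck}` is `s`-regular, then
its order `c²k` is strictly less than `2s²`. -/
theorem regular_odd_other_bound (s c k : ℕ) (hs : 0 < s) (hc : 2 ≤ c) (hk : 1 ≤ k)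
    (hco : Odd c) (hr0 : s % c ≠ 0) (hrh : s % c ≠ (c - 1) / 2)
    (hr3 : ¬ (c = 3 ∧ s % c = 2)) (hreg : SRegular c k s) :
    c ^ 2 * k < 2 * s ^ 2 := by
  obtain ⟨b, hb⟩ := hco
  have hodd : Odd c := ⟨b, hb⟩
  set r := s % c with hr
  set q := s / c with hq
  have hs_eq : c * q + r = s := Nat.div_add_mod s c
  have hrc : r < c := Nat.mod_lt _ (by omega)
  have hparity (i : ℕ) : (i + 2 * q * c) % 2 = i % 2 := by
    rw [mul_assoc, Nat.add_mul_mod_self_left]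
  have hbh : r ≠ b := by omega
  rcases lt_or_gt_of_ne hbh with hlt | hgt
  · have key := hreg.mul_le_sum (by omega) hk (i := 2 * r + 1) (N := 2 * q) (by omega)
      (by nlinarith)
    rw [sum_range_two_mul_succ_sub_mod_two hodd] at key
    have hmul := Nat.mul_le_mul_left c key
    have hr1 : 1 ≤ r := by omega
    nlinarith
  · rcases Nat.lt_or_ge r (c - 1) with hlast | hlast
    · have key := hreg.mul_le_sum (by omega) hk (i := 2 * b - 1) (N := 2 * q + 1) (by omega)
        (by
          rw [add_one_mul, mul_assoc, mul_comm q c]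
          omega)
      rw [Finset.sum_range_succ, sum_range_two_mul_succ_sub_mod_two hodd, hparity,
        show s + 1 - (2 * b - 1) % 2 = s by omega] at key
      have hmul := Nat.mul_le_mul_left c key
      have hs_mul : (2 * b + 2) * s ≤ 2 * r * s := Nat.mul_le_mul_right s (by omega)
      subst hb
      nlinarith
    · have key := hreg.mul_le_sum (by omega) hk (i := 2 * b) (N := 2 * q + 1) (by omega)
        (by
          rw [add_one_mul, mul_assoc, mul_comm q c]
          omega)
      rw [Finset.sum_range_succ, sum_range_two_mul_succ_sub_mod_two hodd, hparity,
        show s + 1 - (2 * b) % 2 = s + 1 by omega] at key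
      have hmul := Nat.mul_le_mul_left c key
      have hrb : r = 2 * b := by omega
      have hb2 : 2 ≤ b := by omega
      have hs_ge : 4 ≤ s := by
        have := Nat.mod_le s c
        omega
      have hs_mul : 2 * s ≤ b * s := Nat.mul_le_mul_right s hb2
      rw [hrb] at hs_eq
      subst hb
      nlinarith
end

section
/- Let s \ge 3 be an integer. (1) If c \ge 2 and k \ge 1 are integers such that the group G = \mathbb{Z}_c \times \mathbb{Z}_{ck} is s-regular, then |G| = c^2 k \le 2s^2 + 2s - 4, and if c^2 k = 2s^2 + 2s - 4 then c = 3 and s \equiv 1 \pmod{3}. (2) Conversely, if s \equiv 1 \pmod{3}, then the group \mathbb{Z}_3 \times \mathbb{Z}_{(2s^2+2s-4)/3}, i.e. \mathbb{Z}_3 \times \mathbb{Z}_{3k} with k = (2s^2+2s-4)/9, is s-regular and has order 2s^2 + 2s - 4. -/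
/-- The closed ball of radius `s` around the origin of `ℤ × ℤ` for the `ℓ¹` norm. -/
noncomputable def l1Ball (s : ℕ) : Finset (ℤ × ℤ) :=
  (Finset.Icc (-(s : ℤ)) s ×ˢ Finset.Icc (-(s : ℤ)) s).filter fun x =>
    x.1.natAbs + x.2.natAbs ≤ s

lemma mem_l1Ball {s : ℕ} {x : ℤ × ℤ} : x ∈ l1Ball s ↔ |x.1| + |x.2| ≤ s := by
  simp only [l1Ball, Finset.mem_filter, Finset.mem_product, Finset.mem_Icc, Int.abs_eq_natAbs]
  omega

/-- In the coordinates `x + y`, `x - y`, the points of the ball of radius `s` whose parity is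
that of `s` form a square grid of side `s + 1`. -/
lemma exists_grid {s : ℕ} {x y : ℤ} (h : |x| + |y| ≤ s) (hp : (x + y) % 2 = (s : ℤ) % 2) :
    ∃ i j : ℕ, i < s + 1 ∧ j < s + 1 ∧ x = i + j - s ∧ y = i - j := by
  have h1 := le_abs_self x
  have h2 := neg_le_abs x
  have h3 := le_abs_self y
  have h4 := neg_le_abs y
  exact ⟨((x + y + s) / 2).toNat, ((x - y + s) / 2).toNat, by omega, by omega, by omega, by omega⟩

/-- The points of the ball of radius `s` whose parity is opposite to that of `s` form a square
grid of side `s`. -/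
lemma exists_grid_of_odd {s : ℕ} {x y : ℤ} (h : |x| + |y| ≤ s)
    (hp : (x + y) % 2 ≠ (s : ℤ) % 2) :
    ∃ i j : ℕ, i < s ∧ j < s ∧ x = i + j - s + 1 ∧ y = i - j := by
  have h1 := le_abs_self x
  have h2 := neg_le_abs x
  have h3 := le_abs_self y
  have h4 := neg_le_abs y
  exact ⟨((x + y + s - 1) / 2).toNat, ((x - y + s - 1) / 2).toNat,
    by omega, by omega, by omega, by omega⟩

lemma card_l1Ball_le (s : ℕ) : (l1Ball s).card ≤ 2 * s ^ 2 + 2 * s + 1 := by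
  let f : ℕ × ℕ → ℤ × ℤ := fun p => (p.1 + p.2 - s, p.1 - p.2)
  let g : ℕ × ℕ → ℤ × ℤ := fun p => (p.1 + p.2 - s + 1, p.1 - p.2)
  have hsub : l1Ball s ⊆ (Finset.range (s + 1) ×ˢ Finset.range (s + 1)).image f ∪
      (Finset.range s ×ˢ Finset.range s).image g := by
    rintro ⟨x, y⟩ hx
    rw [mem_l1Ball] at hx
    simp only [Finset.mem_union, Finset.mem_image, Finset.mem_product, Finset.mem_range]
    by_cases hp : (x + y) % 2 = (s : ℤ) % 2
    · obtain ⟨i, j, hi, hj, rfl, rfl⟩ := exists_grid hx hp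
      exact Or.inl ⟨(i, j), ⟨hi, hj⟩, rfl⟩
    · obtain ⟨i, j, hi, hj, rfl, rfl⟩ := exists_grid_of_odd hx hp
      exact Or.inr ⟨(i, j), ⟨hi, hj⟩, rfl⟩
  calc (l1Ball s).card ≤ _ := Finset.card_le_card hsub
    _ ≤ _ := Finset.card_union_le _ _
    _ ≤ _ := Nat.add_le_add Finset.card_image_le Finset.card_image_le
    _ = 2 * s ^ 2 + 2 * s + 1 := by simp only [Finset.card_product, Finset.card_range]; ring

/-- If the ball covers the quotient `G` of `ℤ²` and `w` is a nonzero kernel element, then the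
points common to the ball and its translate by `w` are redundant. -/
lemma card_add_card_overlap_le {G : Type*} [AddCommGroup G] [Fintype G] {s : ℕ}
    (f : ℤ × ℤ →+ G) (hf : ∀ g, ∃ x ∈ l1Ball s, f x = g) {w : ℤ × ℤ} (hw : w ≠ 0) (hfw : f w = 0)
    {S : Finset (ℤ × ℤ)} (hS : S ⊆ l1Ball s) (hSw : ∀ x ∈ S, x - w ∈ l1Ball s) :
    Fintype.card G + S.card ≤ (l1Ball s).card := by
  classical
  have hpos : 0 < w.1 * w.1 + w.2 * w.2 := by
    rcases w with ⟨p, q⟩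
    by_cases hp : p = 0
    · have hq : q ≠ 0 := by rintro rfl; exact hw (by simp [hp])
      nlinarith [mul_self_pos.2 hq, mul_self_nonneg p]
    · nlinarith [mul_self_pos.2 hp, mul_self_nonneg q]
  have hsurj : ∀ g, ∃ x ∈ l1Ball s \ S, f x = g := by
    intro g
    have hne : ((l1Ball s).filter fun x => f x = g).Nonempty := by
      obtain ⟨x, hx, hg⟩ := hf g
      exact ⟨x, Finset.mem_filter.2 ⟨hx, hg⟩⟩
    obtain ⟨x, hx, hmin⟩ := Finset.exists_min_image _ (fun x => x.1 * w.1 + x.2 * w.2) hne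
    rw [Finset.mem_filter] at hx
    refine ⟨x, Finset.mem_sdiff.2 ⟨hx.1, fun hxS => ?_⟩, hx.2⟩
    have := hmin (x - w) (Finset.mem_filter.2 ⟨hSw x hxS, by rw [map_sub, hfw, sub_zero, hx.2]⟩)
    simp only [Prod.fst_sub, Prod.snd_sub] at this
    nlinarith
  have h1 : (Finset.univ : Finset G) ⊆ (l1Ball s \ S).image f := by
    intro g _
    obtain ⟨x, hx, hg⟩ := hsurj g
    exact Finset.mem_image.2 ⟨x, hx, hg⟩
  have h2 := (Finset.card_le_card h1).trans Finset.card_image_le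
  rw [Finset.card_univ, Finset.card_sdiff_of_subset hS] at h2
  have := Finset.card_le_card hS
  omega

/-- The redundancy bound applied to points of the edge `x + y = s` of the ball. -/
lemma card_add_le_of_edge {G : Type*} [AddCommGroup G] [Fintype G] {s : ℕ}
    (f : ℤ × ℤ →+ G) (hf : ∀ g, ∃ x ∈ l1Ball s, f x = g) {p q : ℤ} (hfw : f (p, q) = 0)
    (hA : 0 < p + q) (hA' : p + q ≤ 2 * s) {lo hi : ℤ} (hlo : 0 ≤ lo) (hhi : hi ≤ s)
    (hlo' : p - q ≤ 2 * lo) (hhi' : 2 * hi ≤ 2 * s + (p - q)) :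
    (Fintype.card G : ℤ) + (hi + 1 - lo) ≤ 2 * s ^ 2 + 2 * s + 1 := by
  have hw : ((p, q) : ℤ × ℤ) ≠ 0 := by
    intro h
    rw [Prod.mk_eq_zero] at h
    omega
  have hS : ∀ x ∈ (Finset.Icc lo hi).image (fun t : ℤ => ((t, s - t) : ℤ × ℤ)),
      x ∈ l1Ball s ∧ x - (p, q) ∈ l1Ball s := by
    intro x hx
    obtain ⟨t, ht, rfl⟩ := Finset.mem_image.1 hx
    rw [Finset.mem_Icc] at ht
    simp only [mem_l1Ball, Prod.mk_sub_mk]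
    constructor <;> grind
  have h := card_add_card_overlap_le f hf hw hfw (fun x hx => (hS x hx).1) fun x hx => (hS x hx).2
  rw [Finset.card_image_of_injective _ fun a b h => (Prod.mk.inj h).1, Int.card_Icc] at h
  have := h.trans (card_l1Ball_le s)
  zify at this
  have := Int.self_le_toNat (hi + 1 - lo)
  omega

/-- The homomorphism `(l₁, l₂) ↦ l₁ • a + l₂ • b`. -/
def pairHom {G : Type*} [AddCommGroup G] (a b : G) : ℤ × ℤ →+ G where
  toFun x := x.1 • a + x.2 • b
  map_zero' := by simp
  map_add' x y := by simp only [Prod.fst_add, Prod.snd_add, add_smul]; abel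

lemma pairHom_apply {G : Type*} [AddCommGroup G] (a b : G) (x : ℤ × ℤ) :
    pairHom a b x = x.1 • a + x.2 • b := rfl

/-- If `(1,u)` and `(1,v)` generate `ℤ_c × ℤ_{ck}`, all relations between them are divisible
by `c`. -/
lemma dvd_of_pairHom_eq_zero {c k : ℕ} {u v : ZMod (c * k)}
    (hf : Function.Surjective (pairHom ((1 : ZMod c), u) ((1 : ZMod c), v))) {p q : ℤ}
    (h : pairHom ((1 : ZMod c), u) ((1 : ZMod c), v) (p, q) = 0) :
    (c : ℤ) ∣ p ∧ (c : ℤ) ∣ q := by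
  obtain ⟨⟨m, n⟩, hmn⟩ := hf (0, 1)
  simp only [pairHom_apply, Prod.smul_mk, Prod.mk_add_mk, Prod.mk_eq_zero, Prod.mk.injEq,
    zsmul_eq_mul, mul_one] at h hmn
  let π := ZMod.castHom (Dvd.intro k rfl) (ZMod c)
  have h1 := congrArg π h.2
  have h2 := congrArg π hmn.2
  simp only [map_add, map_mul, map_intCast, map_zero, map_one] at h1 h2
  have hp : (p : ZMod c) = 0 := by
    linear_combination (-(p : ZMod c)) * h2 + (m : ZMod c) * h1 + (p * π v) * hmn.1 -
      (m * π v) * h.1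
  have hq : (q : ZMod c) = 0 := by linear_combination h.1 - hp
  exact ⟨(ZMod.intCast_zmod_eq_zero_iff_dvd p c).1 hp, (ZMod.intCast_zmod_eq_zero_iff_dvd q c).1 hq⟩

/-- When all relations have even sum, a covering ball can use only one parity class at a time. -/
lemma card_le_of_even_kernel {G : Type*} [AddCommGroup G] [Fintype G] {s : ℕ}
    (f : ℤ × ℤ →+ G) (hf : ∀ g, ∃ x ∈ l1Ball s, f x = g)
    (hker : ∀ x : ℤ × ℤ, f x = 0 → (x.1 + x.2) % 2 = 0) :
    Fintype.card G ≤ 2 * s ^ 2 := by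
  classical
  let F : (ℕ × ℕ) × ℕ → G := fun p =>
    f (((p.1.1 : ℤ) + p.1.2 - s + 1, (p.1.1 : ℤ) - p.1.2) + ((p.2 : ℤ), 0))
  have hsub : (Finset.univ : Finset G) ⊆
      ((Finset.range s ×ˢ Finset.range s) ×ˢ Finset.range 2).image F := by
    intro g _
    obtain ⟨⟨x, y⟩, hx, hg⟩ := hf g
    rw [mem_l1Ball] at hx
    simp only [Finset.mem_image, Finset.mem_product, Finset.mem_range]
    by_cases hp : (x + y) % 2 = (s : ℤ) % 2
    · obtain ⟨⟨x', y'⟩, hx', hg'⟩ := hf (g - f (1, 0))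
      rw [mem_l1Ball] at hx'
      have h0 := hker ((x, y) - (x', y') - (1, 0)) (by
        rw [map_sub, map_sub, hg, hg']; abel)
      simp only [Prod.mk_sub_mk] at h0
      obtain ⟨i, j, hi, hj, rfl, rfl⟩ := exists_grid_of_odd hx' (by omega)
      refine ⟨((i, j), 1), ⟨⟨hi, hj⟩, by norm_num⟩, ?_⟩
      simp only [F, map_add, Nat.cast_one]
      rw [hg', sub_add_cancel]
    · obtain ⟨i, j, hi, hj, rfl, rfl⟩ := exists_grid_of_odd hx hp
      refine ⟨((i, j), 0), ⟨⟨hi, hj⟩, by norm_num⟩, ?_⟩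
      simp only [F, Nat.cast_zero, Prod.mk_zero_zero, add_zero]
      exact hg
  have h := (Finset.card_le_card hsub).trans Finset.card_image_le
  simp only [Finset.card_univ, Finset.card_product, Finset.card_range] at h
  linarith

/-- A group of order `81` whose relations are all divisible by `3` is not covered by the ball
of radius `6`. -/
lemma card_ne_of_radius_six {G : Type*} [AddCommGroup G] [Fintype G]
    (f : ℤ × ℤ →+ G) (hf : ∀ g, ∃ x ∈ l1Ball 6, f x = g)
    (hker : ∀ p q : ℤ, f (p, q) = 0 → 3 ∣ p ∧ 3 ∣ q) : Fintype.card G ≠ 81 := by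
  intro hG
  have key : ∀ w : ℤ × ℤ, w ≠ 0 → f w = 0 →
      ((l1Ball 6).filter fun x => x - w ∈ l1Ball 6).card ≤ 4 := by
    intro w hw hfw
    have := card_add_card_overlap_le f hf hw hfw
      (S := (l1Ball 6).filter fun x => x - w ∈ l1Ball 6) (Finset.filter_subset _ _)
      fun x hx => (Finset.mem_filter.1 hx).2
    have := card_l1Ball_le 6
    omega
  have h1 : f (9, 3) = 0 := by
    obtain ⟨⟨x, y⟩, hx, hg⟩ := hf (f (4, 3))
    rw [mem_l1Ball] at hx
    have h0 : f (4 - x, 3 - y) = 0 := by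
      rw [← Prod.mk_sub_mk, map_sub, hg, sub_self]
    obtain ⟨⟨p, hp⟩, ⟨q, hq⟩⟩ := hker _ _ h0
    obtain rfl : x = 4 - 3 * p := by omega
    obtain rfl : y = 3 - 3 * q := by omega
    have hp0 : 0 ≤ p := by grind
    have hp3 : p ≤ 3 := by grind
    have hq0 : 0 ≤ q := by grind
    have hq3 : q ≤ 2 := by grind
    have h2 := fun h => key _ h h0
    interval_cases p <;> interval_cases q <;> first
      | exact absurd (mem_l1Ball.2 hx) (by decide +kernel)
      | exact absurd (h2 (by decide +kernel)) (by decide +kernel)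
      | exact h0
  have h2 : f (3, 9) = 0 := by
    obtain ⟨⟨x, y⟩, hx, hg⟩ := hf (f (3, 4))
    rw [mem_l1Ball] at hx
    have h0 : f (3 - x, 4 - y) = 0 := by
      rw [← Prod.mk_sub_mk, map_sub, hg, sub_self]
    obtain ⟨⟨p, hp⟩, ⟨q, hq⟩⟩ := hker _ _ h0
    obtain rfl : x = 3 - 3 * p := by omega
    obtain rfl : y = 4 - 3 * q := by omega
    have hp0 : 0 ≤ p := by grind
    have hp3 : p ≤ 2 := by grind
    have hq0 : 0 ≤ q := by grind
    have hq3 : q ≤ 3 := by grind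
    have h2 := fun h => key _ h h0
    interval_cases p <;> interval_cases q <;> first
      | exact absurd (mem_l1Ball.2 hx) (by decide +kernel)
      | exact absurd (h2 (by decide +kernel)) (by decide +kernel)
      | exact h0
  have h3 : f ((9, 3) - (3, 9)) = 0 := by rw [map_sub, h1, h2, sub_zero]
  exact absurd (key _ (by decide) h3) (by decide +kernel)

/-- An `s`-regular group has at most `2s² + 2s - 4` elements, with equality only for `c = 3`. -/
lemma SRegular.card_extremal {s c k : ℕ} (hs : 3 ≤ s) (hc : 2 ≤ c) (hk : 1 ≤ k)
    (h : SRegular c k s) (hD : 2 * s ^ 2 + 2 * s - 4 ≤ c ^ 2 * k) :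
    c ^ 2 * k = 2 * s ^ 2 + 2 * s - 4 ∧ c = 3 ∧ s % 3 = 1 := by
  obtain ⟨u, v, h⟩ := h
  have : NeZero c := ⟨by omega⟩
  have : NeZero k := ⟨by omega⟩
  have : NeZero (c * k) := ⟨Nat.mul_ne_zero (by omega) (by omega)⟩
  set f := pairHom ((1 : ZMod c), u) ((1 : ZMod c), v) with hfdef
  have hf : ∀ g, ∃ x ∈ l1Ball s, f x = g := by
    intro g
    obtain ⟨l1, l2, hl, hg⟩ := h g
    exact ⟨(l1, l2), mem_l1Ball.2 hl, hg.symm⟩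
  have hsurj : Function.Surjective f := fun g => (hf g).imp fun _ hx => hx.2
  have hker : ∀ p q : ℤ, f (p, q) = 0 → (c : ℤ) ∣ p ∧ (c : ℤ) ∣ q := fun p q =>
    dvd_of_pairHom_eq_zero hsurj
  have hcard : Fintype.card (ZMod c × ZMod (c * k)) = c ^ 2 * k := by
    rw [Fintype.card_prod, ZMod.card, ZMod.card]; ring
  have hsq : s * 3 ≤ s ^ 2 := by nlinarith
  have hodd : c % 2 = 1 := by
    by_contra hc2
    have h2c : (2 : ℤ) ∣ c := by omega
    have := card_le_of_even_kernel f hf fun x hx => by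
      have := hker x.1 x.2 hx
      have := h2c.trans this.1
      have := h2c.trans (hker x.1 x.2 hx).2
      omega
    omega
  obtain ⟨⟨x, y⟩, hx, hg⟩ := hf (f (((s + 1) / 2 : ℕ), s + 1 - ((s + 1) / 2 : ℕ)))
  rw [mem_l1Ball] at hx
  obtain ⟨i, hi⟩ : ∃ i : ℤ, i = ((s + 1) / 2 : ℕ) := ⟨_, rfl⟩
  rw [← hi] at hg
  obtain ⟨p, hp⟩ : ∃ p, p = i - x := ⟨_, rfl⟩
  obtain ⟨q, hq⟩ : ∃ q, q = s + 1 - i - y := ⟨_, rfl⟩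
  have h0 : f (p, q) = 0 := by
    rw [hp, hq, ← Prod.mk_sub_mk, map_sub, hg, sub_self]
  obtain ⟨hcp, hcq⟩ := hker _ _ h0
  have hx1 : -(s : ℤ) ≤ x + y := by grind
  have hx2 : x + y ≤ s := by grind
  have hx3 : -(s : ℤ) ≤ x - y := by grind
  have hx4 : x - y ≤ s := by grind
  have hedge : p + q ≤ 2 * s →
      (Fintype.card (ZMod c × ZMod (c * k)) : ℤ) + ((s + 1) / 2 : ℤ) ≤
        2 * s ^ 2 + 2 * s + 1 := by
    intro hA
    have hA0 : 0 < p + q := by omega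
    rcases le_or_gt 0 (p - q) with hB | hB
    · have := card_add_le_of_edge f hf h0 hA0 hA (lo := (p - q + 1) / 2) (hi := s)
        (by omega) (by omega) (by omega) (by omega)
      omega
    · have := card_add_le_of_edge f hf h0 hA0 hA (lo := 0) (hi := (2 * s + (p - q)) / 2)
        (by omega) (by omega) (by omega) (by omega)
      omega
  have hball : c ^ 2 * k ≤ 2 * s ^ 2 + 2 * s + 1 := by
    rw [← hcard, ← Finset.card_univ]
    refine le_trans ?_ (card_l1Ball_le s)
    classical
    exact (Finset.card_le_card fun g _ => Finset.mem_image.2 (hf g)).trans Finset.card_image_le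
  obtain ⟨e, he⟩ := Nat.exists_eq_add_of_le hball
  have he5 : e ≤ 5 := by omega
  rw [hcard] at hedge
  rcases le_or_gt (p + q) (2 * s) with hA | hA
  · have hes : (s + 1) / 2 ≤ e := by
      have := hedge hA
      push_cast at this
      zify at he ⊢
      omega
    have hs10 : s ≤ 10 := by omega
    have hc14 : c ≤ 14 := by
      by_contra hc15
      have : 15 ^ 2 * 1 ≤ c ^ 2 * k := Nat.mul_le_mul (Nat.pow_le_pow_left (by omega) 2) hk
      have : s ^ 2 ≤ 10 ^ 2 := Nat.pow_le_pow_left hs10 2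
      omega
    have h6 : ¬(s = 6 ∧ c ^ 2 * k = 81 ∧ c % 3 = 0) := by
      rintro ⟨rfl, hck, hc3⟩
      have h3 : (3 : ℤ) ∣ c := by omega
      exact card_ne_of_radius_six f hf
        (fun p q h => ⟨h3.trans (hker p q h).1, h3.trans (hker p q h).2⟩) (hcard.trans hck)
    clear hedge hker hsurj hf h hg h0 hcard hball hcp hcq
    interval_cases s <;> interval_cases c <;> omega
  · have hA' : p + q = 2 * s + 1 := by omega
    have hd : (c : ℤ) ∣ 2 * s + 1 := hA' ▸ dvd_add hcp hcq
    have hd2 : (c : ℤ) ^ 2 ∣ 2 * e - 1 := by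
      have h1 : (c : ℤ) ^ 2 ∣ (2 * s + 1) ^ 2 := pow_dvd_pow_of_dvd hd 2
      have h2 : (c : ℤ) ^ 2 ∣ 2 * (c ^ 2 * k) := ⟨2 * k, by ring⟩
      have h3 : (2 * e - 1 : ℤ) = (2 * s + 1) ^ 2 - 2 * (c ^ 2 * k) := by
        zify at he
        linear_combination (-2) * he
      rw [h3]
      exact dvd_sub h1 h2
    have hc3 : c ≤ 3 := by
      by_contra hc4
      have h1 : (16 : ℤ) ≤ c ^ 2 := by exact_mod_cast Nat.pow_le_pow_left (show 4 ≤ c by omega) 2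
      have h2 : (2 * e - 1 : ℤ) = 0 := Int.eq_zero_of_abs_lt_dvd hd2 (by grind)
      omega
    obtain rfl : c = 3 := by omega
    norm_num at hd2
    norm_num at hd
    omega

/-- The lattice generated by `(3n + 3, ±3n)` has covering radius at most `3n + 1`. -/
lemma exists_l1_close {n : ℤ} (hn : 1 ≤ n) (x y : ℤ) :
    ∃ a b : ℤ, (2 : ℤ) ∣ a + b ∧ |x - (3 * n + 3) * a| + |y - 3 * n * b| ≤ 3 * n + 1 := by
  obtain ⟨a, ha⟩ : ∃ a, a = x / (3 * n + 3) := ⟨_, rfl⟩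
  obtain ⟨b, hb⟩ : ∃ b, b = y / (3 * n) := ⟨_, rfl⟩
  have hx := Int.emod_add_mul_ediv x (3 * n + 3)
  have hx0 := Int.emod_nonneg x (show 3 * n + 3 ≠ 0 by omega)
  have hx1 := Int.emod_lt_of_pos x (show 0 < 3 * n + 3 by omega)
  have hy := Int.emod_add_mul_ediv y (3 * n)
  have hy0 := Int.emod_nonneg y (show 3 * n ≠ 0 by omega)
  have hy1 := Int.emod_lt_of_pos y (show 0 < 3 * n by omega)
  rw [← ha] at hx
  rw [← hb] at hy
  set r := x % (3 * n + 3)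
  set t := y % (3 * n)
  have ex : x - (3 * n + 3) * a = r := by linarith
  have ey : y - 3 * n * b = t := by linarith
  have ex' : x - (3 * n + 3) * (a + 1) = r - (3 * n + 3) := by linarith
  have ey' : y - 3 * n * (b + 1) = t - 3 * n := by linarith
  by_cases hab : (2 : ℤ) ∣ a + b
  · by_cases h : r + t ≤ 3 * n + 1
    · exact ⟨a, b, hab, by rw [ex, ey, abs_of_nonneg hx0, abs_of_nonneg hy0]; exact h⟩
    · refine ⟨a + 1, b + 1, by omega, ?_⟩
      rw [ex', ey', abs_of_nonpos (by omega), abs_of_nonpos (by omega)]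
      omega
  · by_cases h : 3 * n + 3 - r + t ≤ 3 * n + 1
    · refine ⟨a + 1, b, by omega, ?_⟩
      rw [ex', ey, abs_of_nonpos (by omega), abs_of_nonneg hy0]
      omega
    · refine ⟨a, b + 1, by omega, ?_⟩
      rw [ex, ey', abs_of_nonneg hx0, abs_of_nonpos (by omega)]
      omega

lemma sRegular_three {n : ℕ} (hn : 1 ≤ n) : SRegular 3 (2 * (n * (n + 1))) (3 * n + 1) := by
  refine ⟨((n : ℤ) : ZMod _), ((n + 1 : ℤ) : ZMod _), ?_⟩
  rintro ⟨α, β⟩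
  obtain ⟨α, rfl⟩ := ZMod.intCast_surjective α
  obtain ⟨β, rfl⟩ := ZMod.intCast_surjective β
  obtain ⟨a, b, ⟨m, hm⟩, hab⟩ :=
    exists_l1_close (n := n) (by exact_mod_cast hn) (-β + (n + 1) * α) (β - n * α)
  refine ⟨_, _, by push_cast; exact hab, ?_⟩
  simp only [Prod.smul_mk, Prod.mk_add_mk, Prod.mk.injEq, zsmul_eq_mul, mul_one]
  constructor
  · rw [← Int.cast_add, ZMod.intCast_eq_intCast_iff_dvd_sub]
    exact ⟨-((n + 1) * a + n * b), by push_cast; ring⟩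
  · rw [← Int.cast_mul, ← Int.cast_mul, ← Int.cast_add,
      ZMod.intCast_eq_intCast_iff_dvd_sub]
    exact ⟨-m, by push_cast; linear_combination (-3 * n * (n + 1) : ℤ) * hm⟩

/-- **Theorem 16.** For `s ≥ 3`: (1) every `s`-regular group `ℤ_c × ℤ_{ck}` (with
`c ≥ 2`, `k ≥ 1`) has order `c²k ≤ 2s² + 2s - 4`, with equality only if `c = 3` and
`s ≡ 1 (mod 3)`; and (2) if `s ≡ 1 (mod 3)`, then `ℤ_3 × ℤ_{(2s²+2s-4)/3}`, i.e.
`ℤ_3 × ℤ_{3k}` with `k = (2s²+2s-4)/9`, is `s`-regular and has order `2s² + 2s - 4`. -/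
theorem regular_max_order (s : ℕ) (hs : 3 ≤ s) :
    (∀ c k : ℕ, 2 ≤ c → 1 ≤ k → SRegular c k s →
      c ^ 2 * k ≤ 2 * s ^ 2 + 2 * s - 4 ∧
      (c ^ 2 * k = 2 * s ^ 2 + 2 * s - 4 → c = 3 ∧ s % 3 = 1)) ∧
    (s % 3 = 1 → SRegular 3 ((2 * s ^ 2 + 2 * s - 4) / 9) s ∧
      9 * ((2 * s ^ 2 + 2 * s - 4) / 9) = 2 * s ^ 2 + 2 * s - 4) := by
  have hsq : s * 3 ≤ s ^ 2 := by nlinarith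
  refine ⟨fun c k hc hk h => ⟨?_, fun heq => ?_⟩, fun h1 => ?_⟩
  · by_contra hlt
    have := (h.card_extremal hs hc hk (by omega)).1
    omega
  · exact (h.card_extremal hs hc hk heq.ge).2
  · obtain ⟨n, rfl⟩ : ∃ n, s = 3 * n + 1 := ⟨s / 3, by omega⟩
    have hn : 1 ≤ n := by omega
    have h9 : 2 * (3 * n + 1) ^ 2 + 2 * (3 * n + 1) - 4 = 9 * (2 * (n * (n + 1))) :=
      Nat.sub_eq_of_eq_add (by ring)
    rw [h9, Nat.mul_div_cancel_left _ (by norm_num)]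
    exact ⟨sRegular_three hn, rfl⟩
end

section
/- Let k and s be positive integers. If the group G = \mathbb{Z}_2 \times \mathbb{Z}_{2k} contains an s-spanning set of size 2, then |G| = 4k \le 2s^2. -/
/-- The abelian group `G` has an `s`-spanning set `{a₁, a₂}` of size 2: `a₁ ≠ a₂` and every
`g ∈ G` is `λ₁ • a₁ + λ₂ • a₂` for some integers `λ₁, λ₂` with `|λ₁| + |λ₂| ≤ s`. -/
def HasSpanningPair (G : Type*) [AddCommGroup G] (s : ℕ) : Prop :=
  ∃ a₁ a₂ : G, a₁ ≠ a₂ ∧ ∀ g : G, ∃ l1 l2 : ℤ,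
    |l1| + |l2| ≤ (s : ℤ) ∧ g = l1 • a₁ + l2 • a₂

open Finset in
/-- At most half of the cells of an `s × s` chessboard have odd coordinate sum. -/
theorem two_mul_card_odd_cells_le (s : ℕ) :
    2 * #{p ∈ range s ×ˢ range s | Odd (p.1 + p.2)} ≤ s ^ 2 := by
  have h : (2 * #{p ∈ range s ×ˢ range s | Odd (p.1 + p.2)} : ℤ)
      = s ^ 2 - (∑ u ∈ range s, (-1 : ℤ) ^ u) ^ 2 := by
    have h1 : (s ^ 2 : ℤ) = ∑ p ∈ range s ×ˢ range s, (1 : ℤ) := by simp [sq]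
    rw [h1, sq, sum_mul_sum, ← sum_product', ← sum_sub_distrib, card_filter]
    push_cast
    rw [mul_sum]
    refine sum_congr rfl fun p _ => ?_
    rw [← pow_add]
    split_ifs with hp
    · rw [hp.neg_one_pow]; norm_num
    · rw [(Nat.not_odd_iff_even.mp hp).neg_one_pow]; norm_num
  zify
  rw [h]
  exact sub_le_self _ (sq_nonneg _)

/-- A pair of vectors spanning `𝔽₂²` is linearly independent. -/
theorem ZMod.two_prod_indep_of_span (x y : ZMod 2 × ZMod 2)
    (hspan : ∀ g, ∃ c d : ZMod 2, g = c • x + d • y) (c d : ZMod 2)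
    (h : c • x + d • y = 0) : c = 0 ∧ d = 0 := by
  revert x y c d
  decide

/-- If `{a, b}` generates `ℤ₂ × ℤ₂ₖ`, then a combination `m • a + n • b` which lies in `2G` has
even coefficients. -/
theorem even_coeffs_of_span {k : ℕ} {a b : ZMod 2 × ZMod (2 * k)}
    (hspan : ∀ g, ∃ m n : ℤ, g = m • a + n • b) {m n : ℤ} {i : ℕ}
    (h : m • a + n • b = (0, ((2 * i : ℕ) : ZMod (2 * k)))) : Even m ∧ Even n := by
  let r : ZMod (2 * k) →+* ZMod 2 := ZMod.castHom (dvd_mul_right 2 k) (ZMod 2)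
  let π : ZMod 2 × ZMod (2 * k) →+ ZMod 2 × ZMod 2 := (AddMonoidHom.id _).prodMap r.toAddMonoidHom
  have hπ (m n : ℤ) : π (m • a + n • b) = (m : ZMod 2) • π a + (n : ZMod 2) • π b := by
    simp only [map_add, map_zsmul, Int.cast_smul_eq_zsmul]
  have hspan' (g) : ∃ c d : ZMod 2, g = c • π a + d • π b := by
    obtain ⟨x, hx⟩ := ZMod.castHom_surjective (dvd_mul_right 2 k) g.2
    obtain ⟨m, n, hmn⟩ := hspan (g.1, x)
    refine ⟨m, n, ?_⟩
    rw [← hπ, ← hmn]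
    exact Prod.ext rfl hx.symm
  have hzero : (m : ZMod 2) • π a + (n : ZMod 2) • π b = 0 := by
    rw [← hπ, h]
    refine Prod.ext rfl ?_
    change r ((2 * i : ℕ) : ZMod (2 * k)) = 0
    rw [map_natCast, ZMod.natCast_eq_zero_iff]
    exact dvd_mul_right 2 i
  obtain ⟨hm, hn⟩ := ZMod.two_prod_indep_of_span _ _ hspan' _ _ hzero
  exact ⟨(ZMod.intCast_eq_zero_iff_even).mp hm, (ZMod.intCast_eq_zero_iff_even).mp hn⟩

/-- **Theorem 17.** If `G = ℤ_2 × ℤ_{2k}` has an `s`-spanning set of size 2, then its order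
`4k` is at most `2s²`. -/
theorem Z2_Z2k_upper_bound (k s : ℕ) (hk : 0 < k) (hs : 0 < s)
    (hspan : HasSpanningPair (ZMod 2 × ZMod (2 * k)) s) :
    4 * k ≤ 2 * s ^ 2 := by
  obtain ⟨a, b, -, hab⟩ := hspan
  have hgen (g : ZMod 2 × ZMod (2 * k)) : ∃ m n : ℤ, g = m • a + n • b := by
    obtain ⟨m, n, -, h⟩ := hab g
    exact ⟨m, n, h⟩
  have key (i : ℕ) : ∃ u v : ℕ, u < s ∧ v < s ∧ Odd (u + v) ∧
      (s : ℤ) • a + (1 : ℤ) • b + (0, ((2 * i : ℕ) : ZMod (2 * k))) =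
        (u + v + 1 - s : ℤ) • a + (u - v : ℤ) • b := by
    obtain ⟨m, n, hle, h⟩ := hab ((s : ℤ) • a + (1 : ℤ) • b + (0, ((2 * i : ℕ) : ZMod (2 * k))))
    have hdiff : (m - s) • a + (n - 1) • b = (0, ((2 * i : ℕ) : ZMod (2 * k))) := by
      rw [sub_smul, sub_smul, sub_add_sub_comm, ← h, add_sub_cancel_left]
    obtain ⟨⟨p, hp⟩, ⟨q, hq⟩⟩ := even_coeffs_of_span hgen hdiff
    have h1 := le_abs_self m
    have h2 := neg_abs_le m
    have h3 := le_abs_self n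
    have h4 := neg_abs_le n
    obtain ⟨u, hu⟩ := Int.eq_ofNat_of_zero_le (a := p + q + s) (by omega)
    obtain ⟨v, hv⟩ := Int.eq_ofNat_of_zero_le (a := p - q + s - 1) (by omega)
    refine ⟨u, v, by omega, by omega, Nat.odd_iff.mpr (by omega), ?_⟩
    rw [h]
    congr 2 <;> omega
  choose U V hU hV hodd hUV using key
  have hcard : (Finset.range k).card ≤
      ((Finset.range s ×ˢ Finset.range s).filter fun p => Odd (p.1 + p.2)).card := by
    refine Finset.card_le_card_of_injOn (fun i => (U i, V i)) (fun i _ => ?_) fun i hi j hj hij => ?_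
    · simp [hU i, hV i, hodd i]
    · obtain ⟨hu, hv⟩ := Prod.mk.inj hij
      have h := hUV i
      rw [hu, hv, ← hUV j, add_right_inj] at h
      have h' := (ZMod.natCast_eq_natCast_iff' _ _ _).mp (Prod.mk.inj h).2
      simp only [Finset.coe_range, Set.mem_Iio] at hi hj
      rw [Nat.mod_eq_of_lt (by omega), Nat.mod_eq_of_lt (by omega)] at h'
      omega
  rw [Finset.card_range] at hcard
  have := two_mul_card_odd_cells_le s
  omega
end

section
/- Let k and s be positive integers with s odd. Then the group \mathbb{Z}_2 \times \mathbb{Z}_{2k} contains an s-spanning set of size 2 if, and only if, k \le (s^2-1)/2. -/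
/-- A generating pair of the Klein four-group is a basis of it over `ZMod 2`. -/
theorem eq_one_of_add_eq_of_spanning_zmod_two :
    ∀ a₁ a₂ b₁ b₂ : ZMod 2,
      (∀ u v : ZMod 2, ∃ x y : ZMod 2, u = x * a₁ + y * b₁ ∧ v = x * a₂ + y * b₂) →
      ∀ x y : ZMod 2, a₁ + b₁ = x * a₁ + y * b₁ → a₂ + b₂ = x * a₂ + y * b₂ →
        x = 1 ∧ y = 1 := by
  decide

/-- If `a` and `b` generate `ZMod 2 × ZMod (2 * k)`, then every representation of an element of
`a + b + 2G` has odd coefficients. -/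
theorem odd_coeffs_of_spanning {k : ℕ} {a b : ZMod 2 × ZMod (2 * k)}
    (h : ∀ g : ZMod 2 × ZMod (2 * k), ∃ l₁ l₂ : ℤ, g = l₁ • a + l₂ • b)
    (t : ZMod (2 * k)) {l₁ l₂ : ℤ} (hl : a + b + (0, 2 * t) = l₁ • a + l₂ • b) :
    Odd l₁ ∧ Odd l₂ := by
  let φ := ZMod.castHom (Dvd.intro k rfl : 2 ∣ 2 * k) (ZMod 2)
  have hφ : Function.Surjective φ := ZMod.ringHom_surjective φ
  have key := eq_one_of_add_eq_of_spanning_zmod_two a.1 (φ a.2) b.1 (φ b.2) ?_ l₁ l₂ ?_ ?_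
  · simpa only [ZMod.intCast_eq_one_iff_odd] using key
  · intro u v
    obtain ⟨w, rfl⟩ := hφ v
    obtain ⟨x, y, hxy⟩ := h (u, w)
    refine ⟨x, y, ?_, ?_⟩
    · simpa using congrArg Prod.fst hxy
    · simpa using congrArg (fun g => φ g.2) hxy
  · simpa using congrArg Prod.fst hl
  · have h2 : φ 2 = 0 := (map_ofNat φ 2).trans rfl
    simpa [h2] using congrArg (fun g => φ g.2) hl

/-- The pairs of odd integers in the `ℓ¹`-ball of odd radius `s = 2 * m + 1` are enumerated by the
natural numbers below `2 * m * (m + 1)`. -/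
theorem exists_index_of_odd_pair (m : ℕ) {l₁ l₂ : ℤ} (h₁ : Odd l₁) (h₂ : Odd l₂)
    (h : |l₁| + |l₂| ≤ 2 * m + 1) :
    ∃ r < 2 * m * (m + 1),
      l₁ = (2 * r + 1 : ℕ) / (2 * m + 1 : ℤ) + (2 * r + 1 : ℕ) % (2 * m + 1 : ℤ) - 2 * m ∧
      l₂ = (2 * r + 1 : ℕ) / (2 * m + 1 : ℤ) - (2 * r + 1 : ℕ) % (2 * m + 1 : ℤ) := by
  obtain ⟨i, rfl⟩ := h₁
  obtain ⟨j, rfl⟩ := h₂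
  obtain ⟨P, hP⟩ : ∃ P : ℤ, P = i + j + 1 + m := ⟨_, rfl⟩
  obtain ⟨D, hD⟩ : ∃ D : ℤ, D = i - j + m := ⟨_, rfl⟩
  have hP0 : 0 ≤ P ∧ P ≤ 2 * m := by
    rcases abs_cases (2 * i + 1) with h | h <;> rcases abs_cases (2 * j + 1) with h' | h' <;> omega
  have hD0 : 0 ≤ D ∧ D ≤ 2 * m := by
    rcases abs_cases (2 * i + 1) with h | h <;> rcases abs_cases (2 * j + 1) with h' | h' <;> omega
  obtain ⟨c, hc⟩ : ∃ c : ℤ, c = m * P + i + m := ⟨_, rfl⟩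
  have hcode : 2 * c + 1 = D + (2 * m + 1) * P := by rw [hc, hP, hD]; ring
  have hc0 : 0 ≤ c := by
    have : 0 ≤ (2 * m + 1) * P := by have := hP0.1; positivity
    omega
  lift c to ℕ using hc0
  have hdiv : (2 * c + 1 : ℤ) / (2 * m + 1) = P := by
    rw [hcode, Int.add_mul_ediv_left _ _ (by omega), Int.ediv_eq_zero_of_lt hD0.1 (by omega),
      zero_add]
  have hmod : (2 * c + 1 : ℤ) % (2 * m + 1) = D := by
    rw [hcode, Int.add_mul_emod_self_left, Int.emod_eq_of_lt hD0.1 (by omega)]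
  refine ⟨c, ?_, ?_, ?_⟩
  · zify
    nlinarith [hP0.2, hD0.2]
  · push_cast
    rw [hdiv, hmod]
    omega
  · push_cast
    rw [hdiv, hmod]
    omega

theorem le_of_hasSpanningPair {k m : ℕ}
    (h : HasSpanningPair (ZMod 2 × ZMod (2 * k)) (2 * m + 1)) : k ≤ 2 * m * (m + 1) := by
  obtain ⟨a, b, -, h⟩ := h
  have hspan : ∀ g : ZMod 2 × ZMod (2 * k), ∃ l₁ l₂ : ℤ, g = l₁ • a + l₂ • b := fun g =>
    let ⟨l₁, l₂, _, hl⟩ := h g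
    ⟨l₁, l₂, hl⟩
  let f : ℕ → ZMod 2 × ZMod (2 * k) := fun r =>
    ((2 * r + 1 : ℕ) / (2 * m + 1 : ℤ) + (2 * r + 1 : ℕ) % (2 * m + 1 : ℤ) - 2 * m : ℤ) • a +
      ((2 * r + 1 : ℕ) / (2 * m + 1 : ℤ) - (2 * r + 1 : ℕ) % (2 * m + 1 : ℤ) : ℤ) • b
  let g : ℕ → ZMod 2 × ZMod (2 * k) := fun t => a + b + (0, 2 * (t : ZMod (2 * k)))
  have hg : Set.InjOn g (Finset.range k) := by
    intro x hx y hy hxy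
    have hx : x < k := by simpa using hx
    have hy : y < k := by simpa using hy
    have h2 : ((2 * x : ℕ) : ZMod (2 * k)) = ((2 * y : ℕ) : ZMod (2 * k)) := by
      simpa [g] using hxy
    rw [ZMod.natCast_eq_natCast_iff'] at h2
    rw [Nat.mod_eq_of_lt (by omega), Nat.mod_eq_of_lt (by omega)] at h2
    omega
  have hsub : (Finset.range k).image g ⊆ (Finset.range (2 * m * (m + 1))).image f := by
    intro x hx
    obtain ⟨t, -, rfl⟩ := Finset.mem_image.mp hx
    obtain ⟨l₁, l₂, hle, hl⟩ := h (g t)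
    obtain ⟨h₁, h₂⟩ := odd_coeffs_of_spanning hspan _ hl
    obtain ⟨r, hr, e₁, e₂⟩ := exists_index_of_odd_pair m h₁ h₂ (by exact_mod_cast hle)
    refine Finset.mem_image.mpr ⟨r, Finset.mem_range.mpr hr, ?_⟩
    rw [hl, e₁, e₂]
  calc k = ((Finset.range k).image g).card := by
        rw [Finset.card_image_of_injOn hg, Finset.card_range]
    _ ≤ ((Finset.range (2 * m * (m + 1))).image f).card := Finset.card_le_card hsub
    _ ≤ 2 * m * (m + 1) := Finset.card_image_le.trans_eq (Finset.card_range _)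

/-- Integers `N` of absolute value at most `2 * m * (m + 1)` are combinations of `m` and `m + 1`
with coefficients in the `ℓ¹`-ball of radius `2 * m + 1` and prescribed parity of their sum. -/
theorem exists_coeffs_of_abs_le (m : ℕ) {N : ℤ} (hN : |N| ≤ 2 * m * (m + 1)) (e : ℤ) :
    ∃ l₁ l₂ : ℤ, |l₁| + |l₂| ≤ 2 * m + 1 ∧ 2 ∣ l₁ + l₂ - e ∧ l₁ * m + l₂ * (m + 1) = N := by
  obtain ⟨c, hc⟩ : ∃ c : ℤ, c = (2 * N + (2 * m + 1) * (1 - e)) / (2 * (2 * m + 1)) := ⟨_, rfl⟩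
  have hlo := Int.mul_ediv_self_le (x := 2 * N + (2 * m + 1) * (1 - e))
    (k := 2 * (2 * m + 1)) (by omega)
  have hhi := Int.lt_mul_ediv_self_add (x := 2 * N + (2 * m + 1) * (1 - e))
    (k := 2 * (2 * m + 1)) (by omega)
  rw [← hc] at hlo hhi
  obtain ⟨p, hp⟩ : ∃ p : ℤ, p = e + 2 * c := ⟨_, rfl⟩
  obtain ⟨q, hq⟩ : ∃ q : ℤ, q = N - p * m := ⟨_, rfl⟩
  obtain ⟨hN₁, hN₂⟩ := abs_le.mp hN
  have hd₁ : 2 * q - p ≤ 2 * m + 1 := by rw [hq, hp]; linarith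
  have hd₂ : -(2 * m + 1) ≤ 2 * q - p := by rw [hq, hp]; linarith
  have hp₁ : p < 2 * m + 2 := by
    by_contra! hcon
    nlinarith
  have hp₂ : -(2 * m + 2) < p := by
    by_contra! hcon
    nlinarith
  refine ⟨p - q, q, ?_, ⟨c, by omega⟩, by rw [hq]; ring⟩
  rcases abs_cases (p - q) with h | h <;> rcases abs_cases q with h' | h' <;> omega

theorem hasSpanningPair_of_le {k m : ℕ} (hk : 0 < k) (hkm : k ≤ 2 * m * (m + 1)) :
    HasSpanningPair (ZMod 2 × ZMod (2 * k)) (2 * m + 1) := by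
  have : NeZero (2 * k) := ⟨by omega⟩
  have : Fact (1 < 2 * k) := ⟨by omega⟩
  refine ⟨(1, m), (1, m + 1), by simp, ?_⟩
  rintro ⟨u, v⟩
  obtain ⟨e, rfl⟩ := ZMod.intCast_surjective u
  have hv : |v.valMinAbs| ≤ 2 * m * (m + 1) := by
    have := v.natAbs_valMinAbs_le
    have h2 : v.valMinAbs.natAbs ≤ 2 * m * (m + 1) := by omega
    rw [Int.abs_eq_natAbs]
    exact_mod_cast h2
  obtain ⟨l₁, l₂, hle, hpar, hl⟩ := exists_coeffs_of_abs_le m hv e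
  refine ⟨l₁, l₂, by exact_mod_cast hle, Prod.ext ?_ ?_⟩
  · have := (ZMod.intCast_eq_intCast_iff_dvd_sub e (l₁ + l₂) 2).mpr hpar
    simpa using this
  · have := congrArg (Int.cast : ℤ → ZMod (2 * k)) hl
    rw [ZMod.coe_valMinAbs] at this
    simpa [mul_add] using this.symm

/-- **Theorem 18.** For positive integers `k` and `s` with `s` odd, the group
`ℤ_2 × ℤ_{2k}` has an `s`-spanning set of size 2 if and only if `k ≤ (s² - 1)/2`. -/
theorem Z2_Z2k_odd_iff (k s : ℕ) (hk : 0 < k) (hs : 0 < s) (hodd : Odd s) :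
    HasSpanningPair (ZMod 2 × ZMod (2 * k)) s ↔ k ≤ (s ^ 2 - 1) / 2 := by
  obtain ⟨m, rfl⟩ := hodd
  have hbound : ((2 * m + 1) ^ 2 - 1) / 2 = 2 * m * (m + 1) := by
    have : (2 * m + 1) ^ 2 = 2 * (2 * m * (m + 1)) + 1 := by ring
    omega
  rw [hbound]
  exact ⟨le_of_hasSpanningPair, hasSpanningPair_of_le hk⟩
end

section
/- Let k and s be positive integers with s even. If k \le (s^2-s)/2, then the group \mathbb{Z}_2 \times \mathbb{Z}_{2k} contains an s-spanning set of size 2. -/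
/-- Every integer `N` with `|N| ≤ c (2c - 1)` is `l1 * c + l2 * (c - 1)` for a pair in the `ℓ¹`-ball of
radius `2c` with even coordinate sum. -/
theorem exists_even_sum_combination (c N : ℤ) (hc : 0 < c) (h₁ : -(c * (2 * c - 1)) ≤ N)
    (h₂ : N ≤ c * (2 * c - 1)) :
    ∃ l1 l2 : ℤ, |l1| + |l2| ≤ 2 * c ∧ Even (l1 + l2) ∧ N = l1 * c + l2 * (c - 1) := by
  have hd : 0 < 2 * c - 1 := by lia
  have hdiv := Int.mul_ediv_add_emod (N + (c - 1)) (2 * c - 1)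
  have hr₀ := Int.emod_nonneg (N + (c - 1)) hd.ne'
  have hr₁ := Int.emod_lt_of_pos (N + (c - 1)) hd
  have hu₀ : -c ≤ (N + (c - 1)) / (2 * c - 1) := by
    rw [Int.le_ediv_iff_mul_le hd]; linarith
  have hu₁ : (N + (c - 1)) / (2 * c - 1) < c + 1 := by
    rw [Int.ediv_lt_iff_lt_mul hd]; linarith
  generalize (N + (c - 1)) / (2 * c - 1) = u at *
  generalize (N + (c - 1)) % (2 * c - 1) = r at *
  refine ⟨u + (r - (c - 1)), u - (r - (c - 1)), ?_, ⟨u, by ring⟩, by linear_combination -hdiv⟩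
  grind

/-- Every integer `N` with `|N| ≤ c (2c - 1)` is `l1 * c + l2 * (c - 1)` for a pair in the `ℓ¹`-ball of
radius `2c` with odd coordinate sum. -/
theorem exists_odd_sum_combination (c N : ℤ) (hc : 0 < c) (h₁ : -(c * (2 * c - 1)) ≤ N)
    (h₂ : N ≤ c * (2 * c - 1)) :
    ∃ l1 l2 : ℤ, |l1| + |l2| ≤ 2 * c ∧ Odd (l1 + l2) ∧ N = l1 * c + l2 * (c - 1) := by
  rcases h₂.eq_or_lt with rfl | h₂
  · refine ⟨2 * c - 1, 0, ?_, ⟨c - 1, by ring⟩, by ring⟩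
    grind
  have hd : 0 < 2 * c - 1 := by lia
  have hdiv := Int.mul_ediv_add_emod (N + c * (2 * c - 1)) (2 * c - 1)
  have hr₀ := Int.emod_nonneg (N + c * (2 * c - 1)) hd.ne'
  have hr₁ := Int.emod_lt_of_pos (N + c * (2 * c - 1)) hd
  have hu₀ : 0 ≤ (N + c * (2 * c - 1)) / (2 * c - 1) := by
    rw [Int.le_ediv_iff_mul_le hd]; linarith
  have hu₁ : (N + c * (2 * c - 1)) / (2 * c - 1) < 2 * c := by
    rw [Int.ediv_lt_iff_lt_mul hd]; linarith
  generalize (N + c * (2 * c - 1)) / (2 * c - 1) = u at *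
  generalize (N + c * (2 * c - 1)) % (2 * c - 1) = r at *
  refine ⟨(u - c) + (r - c) + 1, (u - c) - (r - c), ?_, ⟨u - c, by ring⟩,
    by linear_combination -hdiv⟩
  grind


/-- **Theorem 19.** For positive integers `k` and `s` with `s` even, if `k ≤ (s² - s)/2`
then the group `ℤ_2 × ℤ_{2k}` has an `s`-spanning set of size 2. -/
theorem Z2_Z2k_even_exists (k s : ℕ) (hk : 0 < k) (hs : 0 < s) (heven : Even s)
    (hkle : k ≤ (s ^ 2 - s) / 2) :
    HasSpanningPair (ZMod 2 × ZMod (2 * k)) s := by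
  obtain ⟨c, rfl⟩ := heven
  have hc : (0 : ℤ) < c := by lia
  have hkc : (k : ℤ) ≤ c * (2 * c - 1) := by
    have h : 2 * k + (c + c) ≤ (c + c) ^ 2 := by lia
    zify at h
    linarith
  have : NeZero (2 * k) := ⟨by lia⟩
  have : Fact (1 < 2 * k) := ⟨by lia⟩
  refine ⟨(1, (c : ZMod (2 * k))), (1, (c : ZMod (2 * k)) - 1), ?_, ?_⟩
  · intro h
    exact one_ne_zero (sub_eq_self.mp (Prod.ext_iff.mp h).2.symm)
  rintro ⟨e, x⟩
  have hx := ZMod.valMinAbs_mem_Ioc x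
  have hcast := ZMod.coe_valMinAbs x
  push_cast at hx
  have hx₁ : -((c : ℤ) * (2 * c - 1)) ≤ x.valMinAbs := by linarith [hx.1]
  have hx₂ : x.valMinAbs ≤ (c : ℤ) * (2 * c - 1) := by linarith [hx.2]
  have key : ∃ l1 l2 : ℤ, |l1| + |l2| ≤ 2 * (c : ℤ) ∧ e = ((l1 + l2 : ℤ) : ZMod 2) ∧
      x.valMinAbs = l1 * c + l2 * (c - 1) := by
    obtain rfl | rfl : e = 0 ∨ e = 1 := by
      revert e
      decide
    · obtain ⟨l1, l2, hl, hpar, hN⟩ := exists_even_sum_combination c x.valMinAbs hc hx₁ hx₂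
      exact ⟨l1, l2, hl, (ZMod.intCast_eq_zero_iff_even.mpr hpar).symm, hN⟩
    · obtain ⟨l1, l2, hl, hpar, hN⟩ := exists_odd_sum_combination c x.valMinAbs hc hx₁ hx₂
      exact ⟨l1, l2, hl, (ZMod.intCast_eq_one_iff_odd.mpr hpar).symm, hN⟩
  obtain ⟨l1, l2, hl, he, hN⟩ := key
  refine ⟨l1, l2, by push_cast; linarith, Prod.ext ?_ ?_⟩
  · simp [he]
  · rw [hN] at hcast
    simp [← hcast]
end
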